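/- Under the Algorithm 1 setup with every Φ_{i,t} equal to the identity mapping, with each f_{i,t} being μ_i-strongly convex over X_i with respect to ψ_i (μ_i > 0), and with stepsizes α_t = 1/t^{max{1−κ,κ}}, β_t = 1/t^κ, γ_t = 1/t^{1−κ} for a constant κ ∈ (0,1), for any T ∈ ℕ₊ the sequence x_T generated by Algorithm 1 satisfies Reg(x_T, x̌*_T) ≤ max{C₁, C₄} T^κ, where x̌*_T is a static optimal sequence, C₁ = C_{1,1}/κ + C_{1,2}/(1−max{1−κ,κ}) + 2n·d(X)·K, C₄ = nB₁²/(2κ) + B₁C_{1,1}/κ + C_{1,2}/κ + 2n·d(X)·K·(B₄)^{1−κ}, B₄ = ⌈1/μ̲^{1/κ}⌉, μ̲ = min_i μ_i, C_{1,1} = 3n²τB₁F/(1−λ) + nB₁²/2, C_{1,2} = 4nG²/σ̲, τ = (1 − w/(2n²))^{−2}, λ = (1 − w/(2n²))^{1/ι}, and B₁ = 2F + G·d(X). -/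

import Mathlib

open scoped RealInnerProductSpace

noncomputable section

/-- Bregman divergence generated by `ψ` with gradient map `ψ'`. -/
def breg {d : ℕ} (ψ : EuclideanSpace ℝ (Fin d) → ℝ)
    (ψ' : EuclideanSpace ℝ (Fin d) → EuclideanSpace ℝ (Fin d))
    (x y : EuclideanSpace ℝ (Fin d)) : ℝ :=
  ψ x - ψ y - ⟪ψ' y, x - y⟫

/-- Componentwise positive part `[v]₊`. -/
def posPart {d : ℕ} (v : EuclideanSpace ℝ (Fin d)) : EuclideanSpace ℝ (Fin d) :=
  (WithLp.equiv 2 (Fin d → ℝ)).symm fun j => max (v j) 0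

/-- Build a Euclidean vector from a coordinate function. -/
def vecOf {d : ℕ} (v : Fin d → ℝ) : EuclideanSpace ℝ (Fin d) :=
  (WithLp.equiv 2 (Fin d → ℝ)).symm v

/-- Stack a family of per-agent vectors into the Euclidean product space. -/
def stack {n : ℕ} {p : Fin n → ℕ} (y : ∀ i, EuclideanSpace ℝ (Fin (p i))) :
    PiLp 2 (fun i => EuclideanSpace ℝ (Fin (p i))) :=
  (WithLp.equiv 2 (∀ i, EuclideanSpace ℝ (Fin (p i)))).symm y

/-- The setup and iterates of Algorithm 1 (distributed online primal-dual
dynamic mirror descent) of the paper. -/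
structure Alg (n m : ℕ) (p : Fin n → ℕ) where
  hn : 0 < n
  hm : 0 < m
  X : ∀ i : Fin n, Set (EuclideanSpace ℝ (Fin (p i)))
  hXconvex : ∀ i, Convex ℝ (X i)
  hXcompact : ∀ i, IsCompact (X i)
  hXnonempty : ∀ i, (X i).Nonempty
  dX : ℝ
  hdX : 0 < dX
  hdiam : ∀ u v : PiLp 2 (fun i => EuclideanSpace ℝ (Fin (p i))),
    (∀ i, u i ∈ X i) → (∀ i, v i ∈ X i) → ‖u - v‖ ≤ dX
  f : ℕ → ∀ i : Fin n, EuclideanSpace ℝ (Fin (p i)) → ℝ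
  r : ℕ → ∀ i : Fin n, EuclideanSpace ℝ (Fin (p i)) → ℝ
  g : ℕ → ∀ i : Fin n, EuclideanSpace ℝ (Fin (p i)) → EuclideanSpace ℝ (Fin m)
  hf0 : ∀ i z, f 0 i z = 0
  hr0 : ∀ i z, r 0 i z = 0
  hg0 : ∀ i z, g 0 i z = 0
  hfconvex : ∀ t i, ConvexOn ℝ (X i) (f t i)
  hrconvex : ∀ t i, ConvexOn ℝ (X i) (r t i)
  hgconvex : ∀ t i (j : Fin m), ConvexOn ℝ (X i) (fun z => g t i z j)
  F : ℝ
  hF : 0 < F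
  G : ℝ
  hG : 0 < G
  hfbound : ∀ t i, ∀ z ∈ X i, |f t i z| ≤ F
  hrbound : ∀ t i, ∀ z ∈ X i, |r t i z| ≤ F
  hgbound : ∀ t i, ∀ z ∈ X i, ‖g t i z‖ ≤ F
  Gf : ℕ → ∀ i : Fin n, EuclideanSpace ℝ (Fin (p i)) → EuclideanSpace ℝ (Fin (p i))
  Gr : ℕ → ∀ i : Fin n, EuclideanSpace ℝ (Fin (p i)) → EuclideanSpace ℝ (Fin (p i))
  Gg : ℕ → ∀ i : Fin n, EuclideanSpace ℝ (Fin (p i)) → Fin m → EuclideanSpace ℝ (Fin (p i))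
  hGfsub : ∀ t i, ∀ z ∈ X i, ∀ u ∈ X i, f t i z + ⟪Gf t i z, u - z⟫ ≤ f t i u
  hGrsub : ∀ t i, ∀ z ∈ X i, ∀ u ∈ X i, r t i z + ⟪Gr t i z, u - z⟫ ≤ r t i u
  hGgsub : ∀ t i, ∀ z ∈ X i, ∀ (j : Fin m), ∀ u ∈ X i,
    g t i z j + ⟪Gg t i z j, u - z⟫ ≤ g t i u j
  hGfbound : ∀ t i, ∀ z ∈ X i, ‖Gf t i z‖ ≤ G
  hGrbound : ∀ t i, ∀ z ∈ X i, ‖Gr t i z‖ ≤ G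
  hGgbound : ∀ t i, ∀ z ∈ X i, ∀ v, ‖vecOf (fun j => ⟪Gg t i z j, v⟫)‖ ≤ G * ‖v‖
  W : ℕ → Matrix (Fin n) (Fin n) ℝ
  hWnonneg : ∀ t i j, 0 ≤ W t i j
  hWrow : ∀ t i, ∑ j, W t i j = 1
  hWcol : ∀ t j, ∑ i, W t i j = 1
  w : ℝ
  hw0 : 0 < w
  hw1 : w < 1
  hWdiag : ∀ t i, w ≤ W t i i
  hWpos : ∀ t i j, 0 < W t i j → w ≤ W t i j
  iota : ℕ
  hiota : 0 < iota
  hconn : ∀ (t : ℕ) (c d : Fin n),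
    Relation.ReflTransGen (fun u v : Fin n => ∃ l < iota, 0 < W (t + l) v u) c d
  ψ : ∀ i : Fin n, EuclideanSpace ℝ (Fin (p i)) → ℝ
  ψ' : ∀ i : Fin n, EuclideanSpace ℝ (Fin (p i)) → EuclideanSpace ℝ (Fin (p i))
  hψgrad : ∀ i z, HasGradientAt (ψ i) (ψ' i z) z
  σ : Fin n → ℝ
  hσ : ∀ i, 0 < σ i
  hψstrong : ∀ i, ∀ z ∈ X i, ∀ u ∈ X i,
    ψ i u + ⟪ψ' i u, z - u⟫ + σ i / 2 * ‖z - u‖ ^ 2 ≤ ψ i z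
  K : ℝ
  hK : 0 < K
  hbregLip : ∀ i, ∀ z₁ ∈ X i, ∀ z₂ ∈ X i, ∀ u ∈ X i,
    |breg (ψ i) (ψ' i) z₁ u - breg (ψ i) (ψ' i) z₂ u| ≤ K * ‖z₁ - z₂‖
  Φ : ℕ → ∀ i : Fin n, EuclideanSpace ℝ (Fin (p i)) → EuclideanSpace ℝ (Fin (p i))
  hΦmaps : ∀ t i, ∀ z ∈ X i, Φ t i z ∈ X i
  hΦcontract : ∀ t i, ∀ z ∈ X i, ∀ u ∈ X i,
    breg (ψ i) (ψ' i) (Φ t i z) (Φ t i u) ≤ breg (ψ i) (ψ' i) z u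
  α : ℕ → ℝ
  β : ℕ → ℝ
  γ : ℕ → ℝ
  hαpos : ∀ t, 1 ≤ t → 0 < α t
  hβpos : ∀ t, 1 ≤ t → 0 < β t
  hγpos : ∀ t, 1 ≤ t → 0 < γ t
  hαanti : ∀ s t, 1 ≤ s → s ≤ t → α t ≤ α s
  hβanti : ∀ s t, 1 ≤ s → s ≤ t → β t ≤ β s
  hγanti : ∀ s t, 1 ≤ s → s ≤ t → γ t ≤ γ s
  x : ℕ → ∀ i : Fin n, EuclideanSpace ℝ (Fin (p i))
  xtil : ℕ → ∀ i : Fin n, EuclideanSpace ℝ (Fin (p i))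
  q : ℕ → Fin n → EuclideanSpace ℝ (Fin m)
  qtil : ℕ → Fin n → EuclideanSpace ℝ (Fin m)
  a : ℕ → ∀ i : Fin n, EuclideanSpace ℝ (Fin (p i))
  b : ℕ → Fin n → EuclideanSpace ℝ (Fin m)
  hx0 : ∀ i, x 0 i ∈ X i
  hq0 : ∀ i, q 0 i = 0
  hqtil : ∀ t, 1 ≤ t → ∀ i, qtil t i = ∑ j, W (t - 1) i j • q (t - 1) j
  ha : ∀ t, 1 ≤ t → ∀ i,
    a t i = Gf (t - 1) i (x (t - 1) i) + ∑ j, qtil t i j • Gg (t - 1) i (x (t - 1) i) j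
  hxtilmem : ∀ t, 1 ≤ t → ∀ i, xtil t i ∈ X i
  hxtilmin : ∀ t, 1 ≤ t → ∀ i, ∀ z ∈ X i,
    α t * ⟪xtil t i, a t i⟫ + α t * r (t - 1) i (xtil t i)
        + breg (ψ i) (ψ' i) (xtil t i) (x (t - 1) i)
      ≤ α t * ⟪z, a t i⟫ + α t * r (t - 1) i z + breg (ψ i) (ψ' i) z (x (t - 1) i)
  hb : ∀ t, 1 ≤ t → ∀ i,
    b t i = vecOf (fun j => ⟪Gg (t - 1) i (x (t - 1) i) j, xtil t i - x (t - 1) i⟫)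
      + g (t - 1) i (x (t - 1) i)
  hq : ∀ t, 1 ≤ t → ∀ i,
    q t i = posPart (qtil t i + γ t • (b t i - β t • qtil t i))
  hx : ∀ t, 1 ≤ t → ∀ i, x t i = Φ t i (xtil t i)

namespace Alg

variable {n m : ℕ} {p : Fin n → ℕ}

/-- Average dual variable `q̄_t`. -/
def qbar (S : Alg n m p) (t : ℕ) : EuclideanSpace ℝ (Fin m) :=
  (n : ℝ)⁻¹ • ∑ i, S.q t i

/-- `σ̲ = min_i σ_i`. -/
def sigmin (S : Alg n m p) : ℝ :=
  Finset.univ.inf' (Finset.univ_nonempty_iff.mpr ⟨⟨0, S.hn⟩⟩) S.σ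

/-- `τ = (1 − w/(2n²))⁻²`. -/
def tau (S : Alg n m p) : ℝ := ((1 - S.w / (2 * (n : ℝ) ^ 2)) ^ 2)⁻¹

/-- `λ = (1 − w/(2n²))^{1/ι}`. -/
def lam (S : Alg n m p) : ℝ := (1 - S.w / (2 * (n : ℝ) ^ 2)) ^ ((S.iota : ℝ))⁻¹

/-- `B₁ = 2F + G d(X)`. -/
def B1 (S : Alg n m p) : ℝ := 2 * S.F + S.G * S.dX

/-- `E₁(t) = n²τB₁F Σ_{s=1}^{t−1} γ_{s+1} λ^{t−1−s}`. -/
def E1 (S : Alg n m p) (t : ℕ) : ℝ :=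
  (n : ℝ) ^ 2 * S.tau * S.B1 * S.F *
    ∑ s ∈ Finset.Icc 1 (t - 1), S.γ (s + 1) * S.lam ^ (t - 1 - s)

/-- Global objective `f_t(y) = Σ_i (f_{i,t}(y_i) + r_{i,t}(y_i))`. -/
def fsum (S : Alg n m p) (t : ℕ) (y : ∀ i, EuclideanSpace ℝ (Fin (p i))) : ℝ :=
  ∑ i, (S.f t i (y i) + S.r t i (y i))

/-- Global constraint `g_t(y) = Σ_i g_{i,t}(y_i)`. -/
def gsum (S : Alg n m p) (t : ℕ) (y : ∀ i, EuclideanSpace ℝ (Fin (p i))) :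
    EuclideanSpace ℝ (Fin m) :=
  ∑ i, S.g t i (y i)

/-- Regret against a comparator sequence. -/
def reg (S : Alg n m p) (T : ℕ) (y : ℕ → ∀ i, EuclideanSpace ℝ (Fin (p i))) : ℝ :=
  ∑ t ∈ Finset.Icc 1 T, S.fsum t (S.x t) - ∑ t ∈ Finset.Icc 1 T, S.fsum t (y t)

/-- Feasibility of a comparator sequence on `1..T`. -/
def Feasible (S : Alg n m p) (T : ℕ) (y : ℕ → ∀ i, EuclideanSpace ℝ (Fin (p i))) : Prop :=
  ∀ t ∈ Finset.Icc 1 T, (∀ i, y t i ∈ S.X i) ∧ ∀ j, S.gsum t (y t) j ≤ 0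

/-- Accumulated dynamic variation `V_Φ(y_T)`. -/
def VPhi (S : Alg n m p) (T : ℕ) (y : ℕ → ∀ i, EuclideanSpace ℝ (Fin (p i))) : ℝ :=
  ∑ t ∈ Finset.Icc 1 (T - 1), ∑ i, ‖y (t + 1) i - S.Φ (t + 1) i (y t i)‖

/-- `E₂(t)` for a comparator sequence. -/
def E2 (S : Alg n m p) (y : ℕ → ∀ i, EuclideanSpace ℝ (Fin (p i))) (t : ℕ) : ℝ :=
  (S.α t)⁻¹ * ∑ i, (breg (S.ψ i) (S.ψ' i) (y (t - 1) i) (S.x (t - 1) i)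
    - breg (S.ψ i) (S.ψ' i) (y t i) (S.x t i))

/-- `C_{1,1} = 3n²τB₁F/(1−λ) + nB₁²/2`. -/
def C11 (S : Alg n m p) : ℝ :=
  3 * (n : ℝ) ^ 2 * S.tau * S.B1 * S.F / (1 - S.lam) + (n : ℝ) * S.B1 ^ 2 / 2

/-- `C_{1,2} = 4nG²/σ̲`. -/
def C12 (S : Alg n m p) : ℝ := 4 * (n : ℝ) * S.G ^ 2 / S.sigmin

/-- Constraint violation `‖[Σ_{t=1}^T g_t(x_t)]₊‖`. -/
def violation (S : Alg n m p) (T : ℕ) : ℝ :=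
  ‖posPart (∑ t ∈ Finset.Icc 1 T, S.gsum t (S.x t))‖

end Alg

/-- A family of `n` reals leaves a gap of length `(z i₁ - z i₀) / n` between `z i₀` and `z i₁`. -/
lemma exists_gap {n : ℕ} (z : Fin n → ℝ) (i₀ i₁ : Fin n) (hlt : z i₀ < z i₁) :
    ∃ lo hi : ℝ, hi - lo = (z i₁ - z i₀) / n ∧ (∀ i, z i ≤ lo ∨ hi ≤ z i) ∧
      z i₀ ≤ lo ∧ hi ≤ z i₁ := by
  have hn : (0 : ℝ) < n := by exact_mod_cast i₀.pos
  set h := (z i₁ - z i₀) / n with hh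
  have hpos : 0 < h := div_pos (sub_pos.2 hlt) hn
  have hnh : n * h = z i₁ - z i₀ := by rw [hh]; field_simp
  have key : ∃ k : Fin n, ∀ i, z i < z i₀ + k * h ∨ z i₀ + (k + 1) * h ≤ z i := by
    by_contra hcon
    push Not at hcon
    choose c hc1 hc2 using hcon
    have hinj : Function.Injective c := by
      have hle : ∀ k l : Fin n, c k = c l → k ≤ l := by
        intro k l hkl
        have h1 := hc1 k
        have h2 := hc2 l
        rw [hkl] at h1
        have h3 : (k : ℝ) * h < (l + 1) * h := by linarith
        have h4 : (k : ℝ) < l + 1 := lt_of_mul_lt_mul_right h3 hpos.le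
        have h5 : (k : ℕ) < l + 1 := by exact_mod_cast h4
        exact Fin.le_def.2 (by omega)
      intro k l hkl
      exact le_antisymm (hle k l hkl) (hle l k hkl.symm)
    obtain ⟨k, hk⟩ := (Finite.injective_iff_surjective.1 hinj) i₁
    have h1 := hc2 k
    rw [hk] at h1
    have h2 : ((k : ℕ) : ℝ) + 1 ≤ n := by exact_mod_cast k.2
    nlinarith
  obtain ⟨k, hk⟩ := key
  have hk2 : ((k : ℕ) : ℝ) + 1 ≤ n := by exact_mod_cast k.2
  refine ⟨z i₀ + k * h, z i₀ + (k + 1) * h, by ring, fun i => (hk i).imp le_of_lt id, ?_, ?_⟩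
  · have : (0 : ℝ) ≤ (k : ℕ) * h := by positivity
    linarith
  · nlinarith

/-- Row and column stochastic matrices with nonnegative entries. -/
structure IsDoublyStoch {n : ℕ} (W : Matrix (Fin n) (Fin n) ℝ) : Prop where
  nonneg : ∀ i j, 0 ≤ W i j
  row : ∀ i, ∑ j, W i j = 1
  col : ∀ j, ∑ i, W i j = 1

namespace IsDoublyStoch

variable {n : ℕ} {W : Matrix (Fin n) (Fin n) ℝ}

lemma sum_sq_sub (hW : IsDoublyStoch W) (z : Fin n → ℝ) :
    ∑ i, z i ^ 2 - ∑ i, (∑ j, W i j * z j) ^ 2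
      = ∑ i, ∑ j, W i j * (z j - ∑ k, W i k * z k) ^ 2 := by
  have h1 : ∑ i, z i ^ 2 = ∑ i, ∑ j, W i j * z j ^ 2 := by
    rw [Finset.sum_comm]
    refine Finset.sum_congr rfl fun j _ => ?_
    rw [← Finset.sum_mul, hW.col, one_mul]
  rw [h1, ← Finset.sum_sub_distrib]
  refine Finset.sum_congr rfl fun i _ => ?_
  generalize hy : ∑ k, W i k * z k = y
  have h2 : ∑ j, W i j * (z j - y) ^ 2
      = ∑ j, W i j * z j ^ 2 - 2 * y * ∑ j, W i j * z j + y ^ 2 * ∑ j, W i j := by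
    rw [Finset.mul_sum, Finset.mul_sum, ← Finset.sum_sub_distrib, ← Finset.sum_add_distrib]
    exact Finset.sum_congr rfl fun j _ => by ring
  rw [h2, hW.row, hy]
  ring

lemma sum_sq_le (hW : IsDoublyStoch W) (z : Fin n → ℝ) :
    ∑ i, (∑ j, W i j * z j) ^ 2 ≤ ∑ i, z i ^ 2 := by
  have h := hW.sum_sq_sub z
  have : 0 ≤ ∑ i, ∑ j, W i j * (z j - ∑ k, W i k * z k) ^ 2 :=
    Finset.sum_nonneg fun i _ => Finset.sum_nonneg fun j _ => mul_nonneg (hW.nonneg i j) (sq_nonneg _)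
  linarith

lemma sum_sq_add_le (hW : IsDoublyStoch W) (z : Fin n → ℝ) {w : ℝ} {u v : Fin n} (hw : 0 ≤ w)
    (huv : u ≠ v) (hvv : w ≤ W v v) (hvu : w ≤ W v u) :
    ∑ i, (∑ j, W i j * z j) ^ 2 + w / 2 * (z u - z v) ^ 2 ≤ ∑ i, z i ^ 2 := by
  have h := hW.sum_sq_sub z
  set y := fun i => ∑ k, W i k * z k with hy
  have h1 : ∑ j, W v j * (z j - y v) ^ 2 ≤ ∑ i, ∑ j, W i j * (z j - y i) ^ 2 :=
    Finset.single_le_sum (f := fun i => ∑ j, W i j * (z j - y i) ^ 2)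
      (fun i _ => Finset.sum_nonneg fun j _ => mul_nonneg (hW.nonneg i j) (sq_nonneg _))
      (Finset.mem_univ v)
  have h2 : W v u * (z u - y v) ^ 2 + W v v * (z v - y v) ^ 2
      ≤ ∑ j, W v j * (z j - y v) ^ 2 := by
    rw [← Finset.sum_pair (f := fun j => W v j * (z j - y v) ^ 2) huv]
    exact Finset.sum_le_sum_of_subset_of_nonneg (Finset.subset_univ _)
      fun j _ _ => mul_nonneg (hW.nonneg v j) (sq_nonneg _)
  have h3 : w * (z u - y v) ^ 2 ≤ W v u * (z u - y v) ^ 2 := by gcongr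
  have h4 : w * (z v - y v) ^ 2 ≤ W v v * (z v - y v) ^ 2 := by gcongr
  have h5 : 0 ≤ w / 2 * ((z u - y v) + (z v - y v)) ^ 2 := by positivity
  simp only [hy] at h1 h2 h3 h4 h5
  nlinarith

end IsDoublyStoch

lemma sum_sq_averaging_le {n : ℕ} (W : ℕ → Matrix (Fin n) (Fin n) ℝ)
    (hW : ∀ t, IsDoublyStoch (W t)) {w : ℝ} (hw0 : 0 < w) (hdiag : ∀ t i, w ≤ W t i i)
    (hWpos : ∀ t i j, 0 < W t i j → w ≤ W t i j) {ι : ℕ}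
    (hconn : ∀ c d : Fin n,
      Relation.ReflTransGen (fun u v : Fin n => ∃ l < ι, 0 < W l v u) c d)
    (Z : ℕ → Fin n → ℝ) (hZ : ∀ l i, Z (l + 1) i = ∑ j, W l i j * Z l j)
    (hZ0 : ∑ i, Z 0 i = 0) :
    ∑ i, Z ι i ^ 2 ≤ (1 - 2 * w / n ^ 3) * ∑ i, Z 0 i ^ 2 := by
  have hanti : Antitone fun l => ∑ i, Z l i ^ 2 := by
    refine antitone_nat_of_succ_le fun l => ?_
    simp only [hZ]
    exact (hW l).sum_sq_le (Z l)
  rcases isEmpty_or_nonempty (Fin n) with hemp | hne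
  · simp
  obtain ⟨i₀, h₀⟩ := Finite.exists_min (Z 0)
  obtain ⟨i₁, h₁⟩ := Finite.exists_max (Z 0)
  have hn : (0 : ℝ) < n := by exact_mod_cast i₀.pos
  set M := Z 0 i₁ - Z 0 i₀ with hM
  have hV : ∑ i, Z 0 i ^ 2 ≤ n * M ^ 2 / 4 := by
    set c := (Z 0 i₁ + Z 0 i₀) / 2 with hc
    have e1 : ∑ i, (Z 0 i - c) ^ 2 = ∑ i, Z 0 i ^ 2 + n * c ^ 2 := by
      have : ∑ i, (Z 0 i - c) ^ 2 = ∑ i, Z 0 i ^ 2 - 2 * c * ∑ i, Z 0 i + ∑ _i : Fin n, c ^ 2 := by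
        rw [Finset.mul_sum, ← Finset.sum_sub_distrib, ← Finset.sum_add_distrib]
        exact Finset.sum_congr rfl fun j _ => by ring
      rw [this, hZ0]
      simp
    have e2 : ∑ i, (Z 0 i - c) ^ 2 ≤ ∑ _i : Fin n, M ^ 2 / 4 := by
      refine Finset.sum_le_sum fun i _ => ?_
      have := h₀ i
      have := h₁ i
      nlinarith
    simp only [Finset.sum_const, Finset.card_univ, Fintype.card_fin, nsmul_eq_mul] at e2
    have : 0 ≤ n * c ^ 2 := by positivity
    linarith
  suffices hdec : ∑ i, Z ι i ^ 2 + w / 2 * (M / n) ^ 2 ≤ ∑ i, Z 0 i ^ 2 by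
    have e3 : 2 * w / n ^ 3 * ∑ i, Z 0 i ^ 2 ≤ 2 * w / n ^ 3 * (n * M ^ 2 / 4) := by gcongr
    have e4 : 2 * w / n ^ 3 * (n * M ^ 2 / 4) = w / 2 * (M / n) ^ 2 := by field_simp; ring
    linarith
  rcases (h₀ i₁).eq_or_lt with heq | hlt
  · have : M = 0 := by rw [hM, heq, sub_self]
    simpa [this] using hanti (Nat.zero_le ι)
  obtain ⟨lo, hi, hgap, hsplit, hlo, hhi⟩ := exists_gap (Z 0) i₀ i₁ hlt
  have hlohi : lo < hi := by
    have : 0 < M / n := div_pos (sub_pos.2 hlt) hn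
    rw [← hM] at hgap
    linarith
  let S : Set (Fin n) := {i | hi ≤ Z 0 i}
  have hcross : ∃ l, l < ι ∧ ∃ u v, (u ∈ S ↔ v ∉ S) ∧ 0 < W l v u := by
    by_contra hno
    push Not at hno
    have hstay : ∀ d, Relation.ReflTransGen (fun u v : Fin n => ∃ l < ι, 0 < W l v u) i₁ d →
        d ∈ S := by
      intro d hd
      induction hd with
      | refl => exact hhi
      | tail _ hstep ih =>
        obtain ⟨l, hl, hpos⟩ := hstep
        by_contra hv
        exact absurd hpos (not_lt.2 (hno l hl _ _ ⟨fun _ => hv, fun _ => ih⟩))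
    have := hstay i₀ (hconn i₁ i₀)
    simp only [S, Set.mem_ofPred_eq] at this
    linarith
  classical
  let l := Nat.find hcross
  obtain ⟨hl, u, v, huv, hpos⟩ := Nat.find_spec hcross
  have hinv : ∀ k ≤ l, (∀ i ∈ S, hi ≤ Z k i) ∧ ∀ i ∉ S, Z k i ≤ lo := by
    intro k
    induction k with
    | zero =>
      exact fun _ => ⟨fun i hiS => hiS, fun i hiS => (hsplit i).resolve_right hiS⟩
    | succ k ih =>
      intro hk
      obtain ⟨ihS, ihN⟩ := ih (by omega)
      have hz : ∀ a b, (a ∈ S ↔ b ∉ S) → W k b a = 0 := by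
        intro a b hab
        have hnk := Nat.find_min hcross (show k < Nat.find hcross from hk)
        push Not at hnk
        exact le_antisymm (hnk (by omega) a b hab) ((hW k).nonneg b a)
      constructor
      · intro i hiS
        rw [hZ]
        calc hi = ∑ j, W k i j * hi := by rw [← Finset.sum_mul, (hW k).row, one_mul]
          _ ≤ _ := Finset.sum_le_sum fun j _ => by
            by_cases hj : j ∈ S
            · exact mul_le_mul_of_nonneg_left (ihS j hj) ((hW k).nonneg i j)
            · rw [hz j i (by tauto)]; simp
      · intro i hiS
        rw [hZ]
        calc _ ≤ ∑ j, W k i j * lo := Finset.sum_le_sum fun j _ => by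
              by_cases hj : j ∈ S
              · rw [hz j i (by tauto)]; simp
              · exact mul_le_mul_of_nonneg_left (ihN j hj) ((hW k).nonneg i j)
          _ = lo := by rw [← Finset.sum_mul, (hW k).row, one_mul]
  obtain ⟨hS, hN⟩ := hinv l le_rfl
  have hne : u ≠ v := by
    rintro rfl
    tauto
  have hsq : (M / n) ^ 2 ≤ (Z l u - Z l v) ^ 2 := by
    rw [← hgap]
    by_cases hu : u ∈ S
    · have := hS u hu
      have := hN v (huv.1 hu)
      nlinarith
    · have := hN u hu
      have := hS v (by tauto)
      nlinarith
  have hstep := (hW l).sum_sq_add_le (Z l) hw0.le hne (hdiag l v) (hWpos l v u hpos)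
  simp only [← hZ] at hstep
  have a1 : ∑ i, Z l i ^ 2 ≤ ∑ i, Z 0 i ^ 2 := hanti (Nat.zero_le l)
  have a2 : ∑ i, Z ι i ^ 2 ≤ ∑ i, Z (l + 1) i ^ 2 := hanti (show l + 1 ≤ ι from hl)
  nlinarith

lemma sum_range_comp_sub_le (N : ℕ → ℝ) (hN : ∀ t, 0 ≤ N t) (hN0 : N 0 = 0) (ι K : ℕ) :
    ∑ t ∈ Finset.range K, N (t - ι) ≤ ∑ t ∈ Finset.range K, N t := by
  rcases le_total K ι with h | h
  · rw [Finset.sum_eq_zero (f := fun t => N (t - ι))]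
    · exact Finset.sum_nonneg fun t _ => hN t
    · intro t ht
      rw [Nat.sub_eq_zero_of_le ((Finset.mem_range.1 ht).le.trans h), hN0]
  · obtain ⟨k, rfl⟩ := Nat.exists_eq_add_of_le h
    rw [Finset.sum_range_add, Finset.sum_eq_zero, zero_add]
    · simp only [Nat.add_sub_cancel_left]
      exact Finset.sum_le_sum_of_subset_of_nonneg
        (Finset.range_subset_range.2 (Nat.le_add_left k ι)) fun t _ _ => hN t
    · intro t ht
      rw [Nat.sub_eq_zero_of_le (Finset.mem_range.1 ht).le, hN0]

lemma sum_range_sub_comp_sub_le (E : ℕ → ℝ) (hE : Monotone E) (hE0 : E 0 = 0) (ι K : ℕ) :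
    ∑ t ∈ Finset.range (K + 1), (E t - E (t - ι)) ≤ ι * E K := by
  induction ι with
  | zero => simp
  | succ ι ih =>
    have htel : ∑ t ∈ Finset.range (K + 1), (E (t - ι) - E (t - (ι + 1)))
        = E (K + 1 - (ι + 1)) - E (0 - (ι + 1)) := by
      rw [← Finset.sum_range_sub fun t => E (t - (ι + 1))]
      exact Finset.sum_congr rfl fun t _ => by rw [Nat.add_sub_add_right]
    have hsplit : ∑ t ∈ Finset.range (K + 1), (E t - E (t - (ι + 1)))
        = ∑ t ∈ Finset.range (K + 1), (E t - E (t - ι))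
          + ∑ t ∈ Finset.range (K + 1), (E (t - ι) - E (t - (ι + 1))) := by
      rw [← Finset.sum_add_distrib]
      exact Finset.sum_congr rfl fun t _ => by ring
    have h1 : E (K - ι) ≤ E K := hE (by omega)
    rw [hsplit, htel, Nat.zero_sub, hE0, Nat.add_sub_add_right]
    push_cast
    linarith

/-- A sequence contracting by the factor `ρ` over windows of length `ι`, up to the increments of `E`,
is summable against the last value of `E`. -/
lemma sum_le_of_window_contraction (N E : ℕ → ℝ) (hN : ∀ t, 0 ≤ N t) (hN0 : N 0 = 0)
    (hE : Monotone E) (hE0 : E 0 = 0) {ι : ℕ} {ρ : ℝ} (hρ : 0 ≤ ρ)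
    (hNE : ∀ t, N t ≤ E t) (hstep : ∀ t, N (t + ι) ≤ ρ * N t + (E (t + ι) - E t)) (K : ℕ) :
    (1 - ρ) * ∑ t ∈ Finset.range (K + 1), N t ≤ ι * E K := by
  have h1 : ∀ t, N t ≤ ρ * N (t - ι) + (E t - E (t - ι)) := by
    intro t
    rcases le_total ι t with h | h
    · simpa only [Nat.sub_add_cancel h] using hstep (t - ι)
    · simpa [Nat.sub_eq_zero_of_le h, hN0, hE0] using hNE t
  have h2 := Finset.sum_le_sum fun t (_ : t ∈ Finset.range (K + 1)) => h1 t
  rw [Finset.sum_add_distrib, ← Finset.mul_sum] at h2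
  have h3 := mul_le_mul_of_nonneg_left (sum_range_comp_sub_le N hN hN0 ι (K + 1)) hρ
  have h4 := sum_range_sub_comp_sub_le E hE hE0 ι K
  linarith

section Disagreement

variable {n m : ℕ}

/-- One averaging step with weights `W`. -/
def mixing (W : Matrix (Fin n) (Fin n) ℝ) (z : Fin n → EuclideanSpace ℝ (Fin m)) :
    Fin n → EuclideanSpace ℝ (Fin m) :=
  fun i => ∑ j, W i j • z j

/-- Deviation of a family of vectors from its average. -/
def disagreement (z : Fin n → EuclideanSpace ℝ (Fin m)) :
    PiLp 2 (fun _ : Fin n => EuclideanSpace ℝ (Fin m)) :=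
  WithLp.toLp 2 fun i => z i - (n : ℝ)⁻¹ • ∑ j, z j

lemma disagreement_add (y z : Fin n → EuclideanSpace ℝ (Fin m)) :
    disagreement (y + z) = disagreement y + disagreement z := by
  ext i : 1
  simp only [disagreement, Pi.add_apply, Finset.sum_add_distrib, smul_add, PiLp.add_apply]
  abel

lemma disagreement_zero : disagreement (0 : Fin n → EuclideanSpace ℝ (Fin m)) = 0 := by
  ext i : 1
  simp [disagreement]

lemma mixing_sub (W : Matrix (Fin n) (Fin n) ℝ) (y z : Fin n → EuclideanSpace ℝ (Fin m)) :
    mixing W (y - z) = mixing W y - mixing W z := by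
  ext i : 1
  simp [mixing, smul_sub]

lemma norm_disagreement_sq (z : Fin n → EuclideanSpace ℝ (Fin m)) :
    ‖disagreement z‖ ^ 2 = ∑ k, ∑ i, (z i k - (n : ℝ)⁻¹ * ∑ j, z j k) ^ 2 := by
  rw [PiLp.norm_sq_eq_of_L2, Finset.sum_comm]
  refine Finset.sum_congr rfl fun i _ => ?_
  rw [EuclideanSpace.real_norm_sq_eq]
  simp [disagreement]

lemma norm_disagreement_sq_le (z : Fin n → EuclideanSpace ℝ (Fin m)) :
    ‖disagreement z‖ ^ 2 ≤ ∑ i, ‖z i‖ ^ 2 := by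
  have h : ∑ i, ‖z i‖ ^ 2 = ∑ k, ∑ i, z i k ^ 2 := by
    rw [Finset.sum_comm]
    exact Finset.sum_congr rfl fun i _ => EuclideanSpace.real_norm_sq_eq (z i)
  rw [norm_disagreement_sq, h]
  refine Finset.sum_le_sum fun k _ => ?_
  rcases Nat.eq_zero_or_pos n with rfl | hn
  · simp
  set c := (n : ℝ)⁻¹ * ∑ j, z j k with hc
  have hn' : (n : ℝ) ≠ 0 := by positivity
  have hs : ∑ j, z j k = n * c := by rw [hc, mul_inv_cancel_left₀ hn']
  have : ∑ i, (z i k - c) ^ 2 = ∑ i, z i k ^ 2 - 2 * c * ∑ i, z i k + ∑ _i : Fin n, c ^ 2 := by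
    rw [Finset.mul_sum, ← Finset.sum_sub_distrib, ← Finset.sum_add_distrib]
    exact Finset.sum_congr rfl fun j _ => by ring
  rw [this, hs]
  simp only [Finset.sum_const, Finset.card_univ, Fintype.card_fin, nsmul_eq_mul]
  have : 0 ≤ n * c ^ 2 := by positivity
  linarith

lemma norm_disagreement_le_sqrt_mul (z : Fin n → EuclideanSpace ℝ (Fin m)) {c : ℝ} (hc : 0 ≤ c)
    (hz : ∀ i, ‖z i‖ ≤ c) : ‖disagreement z‖ ≤ √n * c := by
  refine abs_le_of_sq_le_sq' ?_ (by positivity) |>.2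
  rw [mul_pow, Real.sq_sqrt n.cast_nonneg]
  calc ‖disagreement z‖ ^ 2 ≤ ∑ i, ‖z i‖ ^ 2 := norm_disagreement_sq_le z
    _ ≤ ∑ _i : Fin n, c ^ 2 := by
      gcongr with i
      exact hz i
    _ = n * c ^ 2 := by simp

lemma sum_norm_disagreement_le (z : Fin n → EuclideanSpace ℝ (Fin m)) :
    ∑ i, ‖z i - (n : ℝ)⁻¹ • ∑ j, z j‖ ≤ √n * ‖disagreement z‖ := by
  refine abs_le_of_sq_le_sq' ?_ (by positivity) |>.2
  rw [mul_pow, Real.sq_sqrt n.cast_nonneg, PiLp.norm_sq_eq_of_L2]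
  simpa [disagreement] using sq_sum_le_card_mul_sum_sq (s := Finset.univ)
    (f := fun i => ‖z i - (n : ℝ)⁻¹ • ∑ j, z j‖)

lemma IsDoublyStoch.sum_mixing {W : Matrix (Fin n) (Fin n) ℝ} (hW : IsDoublyStoch W)
    (z : Fin n → EuclideanSpace ℝ (Fin m)) : ∑ i, mixing W z i = ∑ i, z i := by
  simp only [mixing]
  rw [Finset.sum_comm]
  refine Finset.sum_congr rfl fun j _ => ?_
  rw [← Finset.sum_smul, hW.col, one_smul]

lemma IsDoublyStoch.mixing_apply_sub {W : Matrix (Fin n) (Fin n) ℝ} (hW : IsDoublyStoch W)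
    (z : Fin n → EuclideanSpace ℝ (Fin m)) (i : Fin n) (k : Fin m) (c : ℝ) :
    mixing W z i k - c = ∑ j, W i j * (z j k - c) := by
  simp only [mul_sub, Finset.sum_sub_distrib, ← Finset.sum_mul, hW.row, one_mul]
  simp [mixing]

lemma IsDoublyStoch.norm_disagreement_mixing_le {W : Matrix (Fin n) (Fin n) ℝ}
    (hW : IsDoublyStoch W) (z : Fin n → EuclideanSpace ℝ (Fin m)) :
    ‖disagreement (mixing W z)‖ ≤ ‖disagreement z‖ := by
  refine abs_le_of_sq_le_sq' ?_ (by positivity) |>.2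
  rw [norm_disagreement_sq, norm_disagreement_sq]
  refine Finset.sum_le_sum fun k _ => ?_
  have h : ∑ j, mixing W z j k = ∑ j, z j k := by
    simpa using congrArg (fun v : EuclideanSpace ℝ (Fin m) => v k) (hW.sum_mixing z)
  simp only [h, hW.mixing_apply_sub]
  exact hW.sum_sq_le _

lemma norm_disagreement_window_le (W : ℕ → Matrix (Fin n) (Fin n) ℝ)
    (hW : ∀ t, IsDoublyStoch (W t)) {w : ℝ} (hw0 : 0 < w) (hw1 : w < 1)
    (hdiag : ∀ t i, w ≤ W t i i) (hWpos : ∀ t i j, 0 < W t i j → w ≤ W t i j) {ι : ℕ}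
    (hconn : ∀ c d : Fin n,
      Relation.ReflTransGen (fun u v : Fin n => ∃ l < ι, 0 < W l v u) c d)
    (hn : 0 < n) (Z : ℕ → Fin n → EuclideanSpace ℝ (Fin m))
    (hZ : ∀ l, Z (l + 1) = mixing (W l) (Z l)) :
    ‖disagreement (Z ι)‖ ≤ (1 - w / n ^ 3) * ‖disagreement (Z 0)‖ := by
  have hn1 : (1 : ℝ) ≤ n := by exact_mod_cast hn
  have hρ : 0 ≤ 1 - w / (n : ℝ) ^ 3 := by
    rw [sub_nonneg, div_le_one (by positivity)]
    exact hw1.le.trans (one_le_pow₀ hn1)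
  have hsum : ∀ l k, ∑ j, Z l j k = ∑ j, Z 0 j k := by
    intro l k
    induction l with
    | zero => rfl
    | succ l ih =>
      rw [← ih, hZ]
      simpa using congrArg (fun v : EuclideanSpace ℝ (Fin m) => v k) ((hW l).sum_mixing (Z l))
  refine abs_le_of_sq_le_sq' ?_ (by positivity) |>.2
  have hsq : 1 - 2 * w / (n : ℝ) ^ 3 ≤ (1 - w / (n : ℝ) ^ 3) ^ 2 := by
    have := sq_nonneg (w / (n : ℝ) ^ 3)
    have e : 2 * w / (n : ℝ) ^ 3 = 2 * (w / (n : ℝ) ^ 3) := by ring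
    rw [e]
    nlinarith
  rw [mul_pow]
  refine le_trans ?_ (mul_le_mul_of_nonneg_right hsq (by positivity))
  rw [norm_disagreement_sq, norm_disagreement_sq, Finset.mul_sum]
  refine Finset.sum_le_sum fun k _ => ?_
  rw [hsum ι k]
  refine sum_sq_averaging_le W hW hw0 hdiag hWpos hconn
    (fun l i => Z l i k - (n : ℝ)⁻¹ * ∑ j, Z 0 j k) (fun l i => ?_) ?_
  · simp only [hZ]
    exact (hW l).mixing_apply_sub (Z l) i k _
  · have : (n : ℝ) ≠ 0 := by positivity
    simp [Finset.sum_sub_distrib, this]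

/-- Iterates of unperturbed averaging with weights `W`, started at `z`. -/
def mixingIter (W : ℕ → Matrix (Fin n) (Fin n) ℝ) (z : Fin n → EuclideanSpace ℝ (Fin m)) :
    ℕ → Fin n → EuclideanSpace ℝ (Fin m)
  | 0 => z
  | l + 1 => mixing (W l) (mixingIter W z l)

/-- Total disagreement of perturbed averaging, bounded by the total size of the perturbations. -/
lemma sum_norm_disagreement_perturbed_le (W : ℕ → Matrix (Fin n) (Fin n) ℝ)
    (hW : ∀ t, IsDoublyStoch (W t)) {w : ℝ} (hw0 : 0 < w) (hw1 : w < 1)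
    (hdiag : ∀ t i, w ≤ W t i i) (hWpos : ∀ t i j, 0 < W t i j → w ≤ W t i j) {ι : ℕ}
    (hconn : ∀ t, ∀ c d : Fin n,
      Relation.ReflTransGen (fun u v : Fin n => ∃ l < ι, 0 < W (t + l) v u) c d)
    (hn : 0 < n) (q ε : ℕ → Fin n → EuclideanSpace ℝ (Fin m)) (hq0 : q 0 = 0)
    (hq : ∀ t, q (t + 1) = mixing (W t) (q t) + ε t) (K : ℕ) :
    w / n ^ 3 * ∑ t ∈ Finset.range (K + 1), ‖disagreement (q t)‖
      ≤ ι * ∑ t ∈ Finset.range K, ‖disagreement (ε t)‖ := by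
  have hn1 : (1 : ℝ) ≤ n := by exact_mod_cast hn
  have hρ : 0 ≤ 1 - w / (n : ℝ) ^ 3 := by
    rw [sub_nonneg, div_le_one (by positivity)]
    exact hw1.le.trans (one_le_pow₀ hn1)
  have htrack : ∀ t l, ‖disagreement (q (t + l) - mixingIter (fun s => W (t + s)) (q t) l)‖
      ≤ ∑ s ∈ Finset.range (t + l), ‖disagreement (ε s)‖
        - ∑ s ∈ Finset.range t, ‖disagreement (ε s)‖ := by
    intro t l
    induction l with
    | zero => simp [mixingIter, disagreement_zero]
    | succ l ih =>
      have e : q (t + (l + 1)) - mixingIter (fun s => W (t + s)) (q t) (l + 1)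
          = mixing (W (t + l)) (q (t + l) - mixingIter (fun s => W (t + s)) (q t) l)
            + ε (t + l) := by
        rw [mixing_sub, ← add_assoc, hq, mixingIter]
        abel
      rw [e, disagreement_add, ← add_assoc, Finset.sum_range_succ]
      have h1 := norm_add_le
        (disagreement (mixing (W (t + l)) (q (t + l) - mixingIter (fun s => W (t + s)) (q t) l)))
        (disagreement (ε (t + l)))
      have h2 := (hW (t + l)).norm_disagreement_mixing_le
        (q (t + l) - mixingIter (fun s => W (t + s)) (q t) l)
      linarith
  have hsplit : ∀ t l, ‖disagreement (q (t + l))‖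
      ≤ ‖disagreement (mixingIter (fun s => W (t + s)) (q t) l)‖
        + (∑ s ∈ Finset.range (t + l), ‖disagreement (ε s)‖
          - ∑ s ∈ Finset.range t, ‖disagreement (ε s)‖) := by
    intro t l
    have e := disagreement_add (mixingIter (fun s => W (t + s)) (q t) l)
      (q (t + l) - mixingIter (fun s => W (t + s)) (q t) l)
    rw [add_sub_cancel] at e
    rw [e]
    exact (norm_add_le _ _).trans (by gcongr; exact htrack t l)
  have h := sum_le_of_window_contraction (fun t => ‖disagreement (q t)‖)
    (fun t => ∑ s ∈ Finset.range t, ‖disagreement (ε s)‖) (fun t => norm_nonneg _)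
    (by simp [hq0, disagreement_zero])
    (monotone_nat_of_le_succ fun t => by simp [Finset.sum_range_succ]) (by simp) (ι := ι) hρ
    ?_ ?_ K
  · simpa using h
  · intro t
    have hz : ∀ l, ‖disagreement (mixingIter (fun s => W (0 + s)) (q 0) l)‖ ≤ 0 := by
      intro l
      induction l with
      | zero => simp [mixingIter, hq0, disagreement_zero]
      | succ l ih => exact ((hW (0 + l)).norm_disagreement_mixing_le _).trans ih
    have := hsplit 0 t
    simp only [zero_add, Finset.range_zero, Finset.sum_empty, sub_zero] at this hz
    exact this.trans (by linarith [hz t])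
  · intro t
    refine (hsplit t ι).trans ?_
    gcongr
    exact norm_disagreement_window_le (fun s => W (t + s)) (fun s => hW _) hw0 hw1
      (fun s => hdiag _) (fun s => hWpos _) (hconn t) hn _ fun l => rfl

end Disagreement

lemma mirror_step_le {d : ℕ} {X : Set (EuclideanSpace ℝ (Fin d))} (hX : Convex ℝ X)
    {ψ r : EuclideanSpace ℝ (Fin d) → ℝ} {ψ' : EuclideanSpace ℝ (Fin d) → EuclideanSpace ℝ (Fin d)}
    (hψ : ∀ z, HasGradientAt ψ (ψ' z) z) (hr : ConvexOn ℝ X r) {α : ℝ} (hα : 0 < α)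
    {a x x' y : EuclideanSpace ℝ (Fin d)} (hx' : x' ∈ X) (hy : y ∈ X)
    (hmin : ∀ z ∈ X, α * ⟪x', a⟫ + α * r x' + breg ψ ψ' x' x
      ≤ α * ⟪z, a⟫ + α * r z + breg ψ ψ' z x) :
    α * (⟪x' - y, a⟫ + (r x' - r y)) ≤ breg ψ ψ' y x - breg ψ ψ' y x' - breg ψ ψ' x' x := by
  set A := α * ⟪y - x', a⟫ + α * (r y - r x') - ⟪ψ' x, y - x'⟫ with hA
  have hline : HasDerivAt (fun s : ℝ => x' + s • (y - x')) (y - x') 0 := by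
    simpa using ((hasDerivAt_id (0 : ℝ)).smul_const (y - x')).const_add x'
  have hφ : HasDerivAt (fun s : ℝ => ψ (x' + s • (y - x'))) ⟪ψ' x', y - x'⟫ 0 := by
    have h0 : HasFDerivAt ψ (InnerProductSpace.toDual ℝ _ (ψ' x')) (x' + (0 : ℝ) • (y - x')) := by
      simpa using (hψ x').hasFDerivAt
    have h1 := h0.comp_hasDerivAt (0 : ℝ) hline
    rwa [InnerProductSpace.toDual_apply_apply] at h1
  have hlim := hφ.tendsto_slope_zero_right
  have hge : -A ≤ ⟪ψ' x', y - x'⟫ := by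
    refine ge_of_tendsto hlim ?_
    filter_upwards [Ioo_mem_nhdsGT (zero_lt_one' ℝ)] with s hs
    obtain ⟨hs0, hs1⟩ := hs
    have hz : x' + s • (y - x') = (1 - s) • x' + s • y := by
      rw [smul_sub, sub_smul, one_smul]; abel
    have hzX : x' + s • (y - x') ∈ X := by
      rw [hz]
      exact hX hx' hy (by linarith) hs0.le (by ring)
    have h1 := hmin _ hzX
    have h2 : r (x' + s • (y - x')) ≤ (1 - s) * r x' + s * r y := by
      rw [hz]
      exact hr.2 hx' hy (by linarith) hs0.le (by ring)
    have h3 := mul_le_mul_of_nonneg_left h2 hα.le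
    simp only [breg, inner_add_left, real_inner_smul_left, add_sub_right_comm x' _ x,
      inner_add_right (ψ' x), real_inner_smul_right] at h1
    simp only [zero_add, zero_smul, add_zero, smul_eq_mul]
    rw [← div_eq_inv_mul, le_div_iff₀ hs0, hA]
    nlinarith
  have e : breg ψ ψ' y x - breg ψ ψ' y x' - breg ψ ψ' x' x
      = ⟪ψ' x', y - x'⟫ - ⟪ψ' x, y - x'⟫ := by
    simp only [breg, inner_sub_right]
    ring
  have e2 : ⟪x' - y, a⟫ = -⟪y - x', a⟫ := by
    rw [← inner_neg_left, neg_sub]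
  rw [e, e2]
  linarith

section PosPart

variable {d : ℕ}

lemma posPart_apply (v : EuclideanSpace ℝ (Fin d)) (j : Fin d) :
    _root_.posPart v j = max (v j) 0 := rfl

lemma norm_sq_le_of_coord_sq_le {u v : EuclideanSpace ℝ (Fin d)} (h : ∀ j, u j ^ 2 ≤ v j ^ 2) :
    ‖u‖ ^ 2 ≤ ‖v‖ ^ 2 := by
  rw [EuclideanSpace.real_norm_sq_eq, EuclideanSpace.real_norm_sq_eq]
  exact Finset.sum_le_sum fun j _ => h j

lemma norm_posPart_sq_le (v : EuclideanSpace ℝ (Fin d)) : ‖_root_.posPart v‖ ^ 2 ≤ ‖v‖ ^ 2 := by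
  refine norm_sq_le_of_coord_sq_le fun j => ?_
  rw [posPart_apply]
  rcases max_cases (v j) 0 with h | h <;> rw [h.1]
  nlinarith [sq_nonneg (v j)]

lemma norm_posPart_le (v : EuclideanSpace ℝ (Fin d)) : ‖_root_.posPart v‖ ≤ ‖v‖ :=
  abs_le_of_sq_le_sq' (norm_posPart_sq_le v) (norm_nonneg v) |>.2

lemma norm_posPart_sub_le {u v : EuclideanSpace ℝ (Fin d)} (hu : ∀ j, 0 ≤ u j) :
    ‖_root_.posPart v - u‖ ≤ ‖v - u‖ := by
  refine abs_le_of_sq_le_sq' (norm_sq_le_of_coord_sq_le fun j => ?_) (norm_nonneg _) |>.2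
  have := hu j
  simp only [PiLp.sub_apply, posPart_apply]
  rcases max_cases (v j) 0 with h | h <;> rw [h.1]
  nlinarith

lemma norm_posPart_le_of_le {u v : EuclideanSpace ℝ (Fin d)} (hu : ∀ j, 0 ≤ u j)
    (huv : ∀ j, v j ≤ u j) : ‖_root_.posPart v‖ ≤ ‖u‖ := by
  refine abs_le_of_sq_le_sq' (norm_sq_le_of_coord_sq_le fun j => ?_) (norm_nonneg _) |>.2
  have := hu j
  have := huv j
  rw [posPart_apply]
  rcases max_cases (v j) 0 with h | h <;> rw [h.1] <;> nlinarith

lemma inner_le_inner_of_nonneg {u v v' : EuclideanSpace ℝ (Fin d)} (hu : ∀ j, 0 ≤ u j)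
    (hv : ∀ j, v j ≤ v' j) : ⟪u, v⟫ ≤ ⟪u, v'⟫ := by
  rw [PiLp.inner_apply, PiLp.inner_apply]
  refine Finset.sum_le_sum fun j _ => ?_
  simpa [mul_comm] using mul_le_mul_of_nonneg_left (hv j) (hu j)

end PosPart

namespace Alg

variable {n m : ℕ} {p : Fin n → ℕ} (S : Alg n m p)

lemma isDoublyStoch (t : ℕ) : IsDoublyStoch (S.W t) := ⟨S.hWnonneg t, S.hWrow t, S.hWcol t⟩

lemma x_succ_eq (hΦid : ∀ t i (z : EuclideanSpace ℝ (Fin (p i))), S.Φ t i z = z) (t : ℕ)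
    (i : Fin n) : S.x (t + 1) i = S.xtil (t + 1) i := by
  rw [S.hx _ (Nat.le_add_left 1 t), hΦid]

lemma x_mem (t : ℕ) (i : Fin n) : S.x t i ∈ S.X i := by
  cases t with
  | zero => exact S.hx0 i
  | succ t =>
    rw [S.hx _ (Nat.le_add_left 1 t)]
    exact S.hΦmaps _ _ _ (S.hxtilmem _ (Nat.le_add_left 1 t) i)

lemma norm_sub_le {i : Fin n} {u v : EuclideanSpace ℝ (Fin (p i))} (hu : u ∈ S.X i)
    (hv : v ∈ S.X i) : ‖u - v‖ ≤ S.dX := by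
  classical
  choose e he using S.hXnonempty
  have hmem : ∀ z ∈ S.X i, ∀ k, Function.update e i z k ∈ S.X k := by
    intro z hz k
    rcases eq_or_ne k i with rfl | hk
    · simpa using hz
    · simpa [hk] using he k
  have h := S.hdiam (WithLp.toLp 2 (Function.update e i u)) (WithLp.toLp 2 (Function.update e i v))
    (hmem u hu) (hmem v hv)
  refine le_trans ?_ h
  simpa using PiLp.norm_apply_le
    (WithLp.toLp 2 (Function.update e i u) - WithLp.toLp 2 (Function.update e i v)) i

lemma q_nonneg (t : ℕ) (i : Fin n) (j : Fin m) : 0 ≤ S.q t i j := by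
  cases t with
  | zero => simp [S.hq0]
  | succ t =>
    rw [S.hq _ (Nat.le_add_left 1 t), posPart_apply]
    exact le_max_right _ _

lemma qtil_succ (t : ℕ) : S.qtil (t + 1) = mixing (S.W t) (S.q t) := by
  ext i : 1
  rw [S.hqtil _ (Nat.le_add_left 1 t)]
  rfl

lemma qtil_nonneg (t : ℕ) (i : Fin n) (j : Fin m) : 0 ≤ S.qtil (t + 1) i j := by
  rw [S.qtil_succ]
  simp only [mixing, WithLp.ofLp_sum, WithLp.ofLp_smul, Finset.sum_apply, Pi.smul_apply,
    smul_eq_mul]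
  exact Finset.sum_nonneg fun k _ => mul_nonneg (S.hWnonneg t i k) (S.q_nonneg t k j)

lemma b_succ_apply (t : ℕ) (i : Fin n) (j : Fin m) :
    S.b (t + 1) i j
      = ⟪S.Gg t i (S.x t i) j, S.xtil (t + 1) i - S.x t i⟫ + S.g t i (S.x t i) j := by
  rw [S.hb _ (Nat.le_add_left 1 t)]
  rfl

lemma b_succ_le (t : ℕ) (i : Fin n) (j : Fin m) :
    S.b (t + 1) i j ≤ S.g t i (S.xtil (t + 1) i) j := by
  rw [b_succ_apply, add_comm]
  exact S.hGgsub t i _ (S.x_mem t i) j _ (S.hxtilmem _ (Nat.le_add_left 1 t) i)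

lemma q_one (i : Fin n) : S.q 1 i = 0 := by
  ext j
  have hqt : S.qtil (0 + 1) i = 0 := by simp [S.qtil_succ, mixing, S.hq0]
  rw [S.hq 1 le_rfl, posPart_apply]
  have hb := S.b_succ_le 0 i j
  rw [S.hg0] at hb
  have hγ := S.hγpos 1 le_rfl
  rw [zero_add] at hqt hb
  simp only [hqt, smul_zero, sub_zero, zero_add, PiLp.smul_apply, smul_eq_mul, PiLp.zero_apply]
    at hb ⊢
  exact max_eq_right (mul_nonpos_of_nonneg_of_nonpos hγ.le hb)

lemma norm_qtil_succ_le {t : ℕ} {c : ℝ} (hc : ∀ i, ‖S.q t i‖ ≤ c) (i : Fin n) :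
    ‖S.qtil (t + 1) i‖ ≤ c := by
  rw [S.qtil_succ]
  calc ‖mixing (S.W t) (S.q t) i‖ ≤ ∑ j, S.W t i j * c := by
        refine norm_sum_le_of_le _ fun j _ => ?_
        rw [norm_smul, Real.norm_of_nonneg (S.hWnonneg t i j)]
        exact mul_le_mul_of_nonneg_left (hc j) (S.hWnonneg t i j)
    _ = c := by rw [← Finset.sum_mul, S.hWrow, one_mul]

lemma sum_norm_qtil_sq_le (t : ℕ) : ∑ i, ‖S.qtil (t + 1) i‖ ^ 2 ≤ ∑ i, ‖S.q t i‖ ^ 2 := by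
  have h : ∀ z : Fin n → EuclideanSpace ℝ (Fin m), ∑ i, ‖z i‖ ^ 2 = ∑ k, ∑ i, z i k ^ 2 := by
    intro z
    rw [Finset.sum_comm]
    exact Finset.sum_congr rfl fun i _ => EuclideanSpace.real_norm_sq_eq (z i)
  rw [h, h, S.qtil_succ]
  refine Finset.sum_le_sum fun k _ => ?_
  simpa [mixing] using (S.isDoublyStoch t).sum_sq_le fun j => S.q t j k

lemma norm_q_le (hγβ : ∀ t, 1 ≤ t → S.γ t * S.β t ≤ 1) (t : ℕ) (i : Fin n) :
    ‖S.q t i‖ ≤ S.F / S.β (t + 1) := by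
  induction t generalizing i with
  | zero =>
    rw [S.hq0, norm_zero]
    exact div_nonneg S.hF.le (S.hβpos _ le_rfl).le
  | succ t ih =>
    have h1 : 1 ≤ t + 1 := Nat.le_add_left 1 t
    have hβ := S.hβpos _ h1
    have hγ := S.hγpos _ h1
    have hqt := S.norm_qtil_succ_le ih i
    have hc : 0 ≤ 1 - S.γ (t + 1) * S.β (t + 1) := sub_nonneg.2 (hγβ _ h1)
    rw [S.hq _ h1]
    have key : ‖_root_.posPart (S.qtil (t + 1) i
          + S.γ (t + 1) • (S.b (t + 1) i - S.β (t + 1) • S.qtil (t + 1) i))‖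
        ≤ ‖(1 - S.γ (t + 1) * S.β (t + 1)) • S.qtil (t + 1) i
          + S.γ (t + 1) • _root_.posPart (S.g t i (S.xtil (t + 1) i))‖ := by
      refine norm_posPart_le_of_le (fun j => ?_) fun j => ?_
      · simp only [PiLp.add_apply, PiLp.smul_apply, smul_eq_mul, posPart_apply]
        exact add_nonneg (mul_nonneg hc (S.qtil_nonneg t i j))
          (mul_nonneg hγ.le (le_max_right _ _))
      · simp only [PiLp.add_apply, PiLp.sub_apply, PiLp.smul_apply, smul_eq_mul, posPart_apply]
        have := mul_le_mul_of_nonneg_left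
          ((S.b_succ_le t i j).trans (le_max_left _ 0)) hγ.le
        linarith
    have hg : ‖_root_.posPart (S.g t i (S.xtil (t + 1) i))‖ ≤ S.F :=
      (norm_posPart_le _).trans (S.hgbound t i _ (S.hxtilmem _ h1 i))
    refine key.trans ((norm_add_le _ _).trans ?_)
    rw [norm_smul, norm_smul, Real.norm_of_nonneg hc, Real.norm_of_nonneg hγ.le]
    calc (1 - S.γ (t + 1) * S.β (t + 1)) * ‖S.qtil (t + 1) i‖
          + S.γ (t + 1) * ‖_root_.posPart (S.g t i (S.xtil (t + 1) i))‖
        ≤ (1 - S.γ (t + 1) * S.β (t + 1)) * (S.F / S.β (t + 1)) + S.γ (t + 1) * S.F := by gcongr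
      _ = S.F / S.β (t + 1) := by field_simp; ring
      _ ≤ S.F / S.β (t + 1 + 1) := div_le_div_of_nonneg_left S.hF.le
          (S.hβpos _ (by omega)) (S.hβanti _ _ h1 (Nat.le_succ _))

lemma norm_b_succ_le (t : ℕ) (i : Fin n) : ‖S.b (t + 1) i‖ ≤ S.F + S.G * S.dX := by
  have h1 : 1 ≤ t + 1 := Nat.le_add_left 1 t
  rw [S.hb _ h1, add_comm S.F]
  refine (norm_add_le _ _).trans (add_le_add ?_ (S.hgbound t i _ (S.x_mem t i)))
  exact (S.hGgbound t i _ (S.x_mem t i) _).trans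
    (mul_le_mul_of_nonneg_left (S.norm_sub_le (S.hxtilmem _ h1 i) (S.x_mem t i)) S.hG.le)

lemma norm_b_sub_le (hγβ : ∀ t, 1 ≤ t → S.γ t * S.β t ≤ 1) (t : ℕ) (i : Fin n) :
    ‖S.b (t + 1) i - S.β (t + 1) • S.qtil (t + 1) i‖ ≤ S.B1 := by
  have hβ := S.hβpos _ (Nat.le_add_left 1 t)
  have h1 := S.norm_b_succ_le t i
  have h2 := S.norm_qtil_succ_le (S.norm_q_le hγβ t) i
  have h3 : ‖S.β (t + 1) • S.qtil (t + 1) i‖ ≤ S.F := by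
    rw [norm_smul, Real.norm_of_nonneg hβ.le]
    rwa [le_div_iff₀' hβ] at h2
  refine (_root_.norm_sub_le _ _).trans ?_
  rw [B1]
  linarith

lemma norm_q_sub_qtil_le (hγβ : ∀ t, 1 ≤ t → S.γ t * S.β t ≤ 1) (t : ℕ) (i : Fin n) :
    ‖S.q (t + 1) i - S.qtil (t + 1) i‖ ≤ S.γ (t + 1) * S.B1 := by
  have h1 : 1 ≤ t + 1 := Nat.le_add_left 1 t
  rw [S.hq _ h1]
  refine (norm_posPart_sub_le (S.qtil_nonneg t i)).trans ?_
  rw [add_sub_cancel_left, norm_smul, Real.norm_of_nonneg (S.hγpos _ h1).le]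
  exact mul_le_mul_of_nonneg_left (S.norm_b_sub_le hγβ t i) (S.hγpos _ h1).le

lemma dual_descent (hγβ : ∀ t, 1 ≤ t → S.γ t * S.β t ≤ 1) (t : ℕ) (i : Fin n) :
    -⟪S.qtil (t + 1) i, S.b (t + 1) i⟫
      ≤ (2 * S.γ (t + 1))⁻¹ * (‖S.qtil (t + 1) i‖ ^ 2 - ‖S.q (t + 1) i‖ ^ 2)
        - S.β (t + 1) * ‖S.qtil (t + 1) i‖ ^ 2 + S.γ (t + 1) / 2 * S.B1 ^ 2 := by
  have h1 : 1 ≤ t + 1 := Nat.le_add_left 1 t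
  have hγ := S.hγpos _ h1
  have h2 := norm_posPart_sq_le (S.qtil (t + 1) i
    + S.γ (t + 1) • (S.b (t + 1) i - S.β (t + 1) • S.qtil (t + 1) i))
  rw [← S.hq _ h1, norm_add_sq_real, norm_smul, Real.norm_of_nonneg hγ.le, real_inner_smul_right,
    inner_sub_right, real_inner_smul_right, real_inner_self_eq_norm_sq, mul_pow] at h2
  have h3 : ‖S.b (t + 1) i - S.β (t + 1) • S.qtil (t + 1) i‖ ^ 2 ≤ S.B1 ^ 2 := by
    gcongr
    exact S.norm_b_sub_le hγβ t i
  have h4 := mul_le_mul_of_nonneg_left h3 (sq_nonneg (S.γ (t + 1)))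
  rw [← mul_le_mul_iff_right₀ (mul_pos two_pos hγ)]
  have e : 2 * S.γ (t + 1) * ((2 * S.γ (t + 1))⁻¹ *
      (‖S.qtil (t + 1) i‖ ^ 2 - ‖S.q (t + 1) i‖ ^ 2)
        - S.β (t + 1) * ‖S.qtil (t + 1) i‖ ^ 2 + S.γ (t + 1) / 2 * S.B1 ^ 2)
      = ‖S.qtil (t + 1) i‖ ^ 2 - ‖S.q (t + 1) i‖ ^ 2
        - 2 * S.γ (t + 1) * S.β (t + 1) * ‖S.qtil (t + 1) i‖ ^ 2
        + S.γ (t + 1) ^ 2 * S.B1 ^ 2 := by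
    field_simp
  rw [e]
  linarith

lemma breg_ge {i : Fin n} {u v : EuclideanSpace ℝ (Fin (p i))} (hu : u ∈ S.X i)
    (hv : v ∈ S.X i) : S.σ i / 2 * ‖u - v‖ ^ 2 ≤ breg (S.ψ i) (S.ψ' i) u v := by
  have := S.hψstrong i u hu v hv
  rw [breg]
  linarith

lemma breg_nonneg {i : Fin n} {u v : EuclideanSpace ℝ (Fin (p i))} (hu : u ∈ S.X i)
    (hv : v ∈ S.X i) : 0 ≤ breg (S.ψ i) (S.ψ' i) u v :=
  le_trans (by have := S.hσ i; positivity) (S.breg_ge hu hv)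

lemma breg_le {i : Fin n} {u v : EuclideanSpace ℝ (Fin (p i))} (hu : u ∈ S.X i)
    (hv : v ∈ S.X i) : breg (S.ψ i) (S.ψ' i) u v ≤ S.K * S.dX := by
  have h := S.hbregLip i u hu v hv v hv
  have h0 : breg (S.ψ i) (S.ψ' i) v v = 0 := by simp [breg]
  rw [h0, sub_zero] at h
  exact (le_abs_self _).trans
    (h.trans (mul_le_mul_of_nonneg_left (S.norm_sub_le hu hv) S.hK.le))

lemma sigmin_pos : 0 < S.sigmin := by
  rw [sigmin, Finset.lt_inf'_iff]
  exact fun i _ => S.hσ i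

lemma sigmin_le (i : Fin n) : S.sigmin ≤ S.σ i := Finset.inf'_le _ (Finset.mem_univ i)

/-- One-step regret of a single agent. -/
lemma primal_descent (hΦid : ∀ t i (z : EuclideanSpace ℝ (Fin (p i))), S.Φ t i z = z)
    (μ : Fin n → ℝ)
    (hstrconv : ∀ t : ℕ, 1 ≤ t → ∀ i, ∀ z ∈ S.X i, ∀ u ∈ S.X i,
      S.f t i u + ⟪z - u, S.Gf t i u⟫ + μ i * breg (S.ψ i) (S.ψ' i) z u ≤ S.f t i z)
    {t : ℕ} (ht : 1 ≤ t) (i : Fin n) {y : EuclideanSpace ℝ (Fin (p i))} (hy : y ∈ S.X i) :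
    S.f t i (S.x t i) + S.r t i (S.x t i) - (S.f t i y + S.r t i y)
      ≤ 2 * S.G ^ 2 / S.sigmin * S.α (t + 1)
        + ((S.α (t + 1))⁻¹ * (breg (S.ψ i) (S.ψ' i) y (S.x t i)
            - breg (S.ψ i) (S.ψ' i) y (S.x (t + 1) i))
          - μ i * breg (S.ψ i) (S.ψ' i) y (S.x t i))
        - ⟪S.qtil (t + 1) i, S.b (t + 1) i⟫ + ⟪S.qtil (t + 1) i, S.g t i y⟫ := by
  have h1 : 1 ≤ t + 1 := Nat.le_add_left 1 t
  have hα := S.hαpos _ h1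
  have hxX := S.x_mem t i
  have hx'X := S.x_mem (t + 1) i
  have hmir := mirror_step_le (S.hXconvex i) (S.hψgrad i) (S.hrconvex t i) hα
    (S.hxtilmem _ h1 i) hy (S.hxtilmin _ h1 i)
  simp only [Nat.add_sub_cancel] at hmir
  rw [← S.x_succ_eq hΦid] at hmir
  set x := S.x t i with hx
  set x' := S.x (t + 1) i with hx'
  set q' := S.qtil (t + 1) i with hq'
  have hf := hstrconv t ht i y hy x hxX
  have hfx : ⟪x - x', S.Gf t i x⟫ ≤ S.G * ‖x' - x‖ := by
    rw [norm_sub_rev x' x, mul_comm]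
    exact (real_inner_le_norm _ _).trans
      (mul_le_mul_of_nonneg_left (S.hGfbound t i x hxX) (norm_nonneg _))
  have hrx : S.r t i x - S.r t i x' ≤ S.G * ‖x' - x‖ := by
    have h2 := S.hGrsub t i x hxX x' hx'X
    have h3 := real_inner_le_norm (-S.Gr t i x) (x' - x)
    rw [norm_neg, inner_neg_left] at h3
    have h4 := mul_le_mul_of_nonneg_right (S.hGrbound t i x hxX) (norm_nonneg (x' - x))
    linarith
  have ha : ⟪x' - y, S.a (t + 1) i⟫
      = ⟪x' - y, S.Gf t i x⟫ + ∑ j, q' j * ⟪S.Gg t i x j, x' - y⟫ := by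
    rw [S.ha _ h1, inner_add_right, inner_sum]
    simp only [Nat.add_sub_cancel, real_inner_smul_right, ← hx, ← hq']
    simp only [real_inner_comm]
  have hgrad : ⟪q', S.b (t + 1) i⟫ - ⟪q', S.g t i y⟫ ≤ ∑ j, q' j * ⟪S.Gg t i x j, x' - y⟫ := by
    rw [PiLp.inner_apply, PiLp.inner_apply, ← Finset.sum_sub_distrib]
    refine Finset.sum_le_sum fun j _ => ?_
    have h2 := S.hGgsub t i x hxX j y hy
    have h3 := S.b_succ_apply t i j
    rw [← S.x_succ_eq hΦid, ← hx, ← hx'] at h3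
    have h4 : S.b (t + 1) i j - S.g t i y j ≤ ⟪S.Gg t i x j, x' - y⟫ := by
      rw [h3, ← sub_sub_sub_cancel_right x' y x, inner_sub_right _ (x' - x)]
      linarith
    have h5 := mul_le_mul_of_nonneg_left h4 (S.qtil_nonneg t i j)
    simp only [RCLike.inner_apply, conj_trivial]
    rw [hq']
    linarith
  have hstrong := S.breg_ge hx'X hxX
  have hσ : S.sigmin / 2 * ‖x' - x‖ ^ 2 ≤ breg (S.ψ i) (S.ψ' i) x' x :=
    le_trans (by gcongr; exact S.sigmin_le i) hstrong
  have hσpos := S.sigmin_pos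
  have hmir' : ⟪x' - y, S.a (t + 1) i⟫ + (S.r t i x' - S.r t i y)
      ≤ (S.α (t + 1))⁻¹ * (breg (S.ψ i) (S.ψ' i) y x - breg (S.ψ i) (S.ψ' i) y x')
        - (S.α (t + 1))⁻¹ * (S.sigmin / 2 * ‖x' - x‖ ^ 2) := by
    rw [← mul_sub, ← div_eq_inv_mul, le_div_iff₀' hα]
    linarith
  have hamgm : 2 * S.G * ‖x' - x‖ - (S.α (t + 1))⁻¹ * (S.sigmin / 2 * ‖x' - x‖ ^ 2)
      ≤ 2 * S.G ^ 2 / S.sigmin * S.α (t + 1) := by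
    have e : 2 * S.G ^ 2 / S.sigmin * S.α (t + 1)
        - (2 * S.G * ‖x' - x‖ - (S.α (t + 1))⁻¹ * (S.sigmin / 2 * ‖x' - x‖ ^ 2))
        = (2 * S.G * S.α (t + 1) - S.sigmin * ‖x' - x‖) ^ 2
          / (2 * S.sigmin * S.α (t + 1)) := by
      field_simp
      ring
    have : 0 ≤ (2 * S.G * S.α (t + 1) - S.sigmin * ‖x' - x‖) ^ 2
          / (2 * S.sigmin * S.α (t + 1)) := by positivity
    linarith
  have esplit : ⟪y - x, S.Gf t i x⟫ = -⟪x - x', S.Gf t i x⟫ - ⟪x' - y, S.Gf t i x⟫ := by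
    simp only [inner_sub_left]
    ring
  rw [esplit] at hf
  rw [ha] at hmir'
  linarith

end Alg

lemma sum_Icc_rpow_inv_le {a : ℝ} (ha0 : 0 < a) (ha1 : a < 1) (T : ℕ) :
    ∑ t ∈ Finset.Icc 1 T, ((t : ℝ) ^ (1 - a))⁻¹ ≤ (T : ℝ) ^ a / a := by
  induction T with
  | zero => simp [Real.zero_rpow ha0.ne']
  | succ T ih =>
    rw [Finset.sum_Icc_succ_top (Nat.le_add_left 1 T)]
    push_cast
    set s : ℝ := (T : ℝ) + 1 with hs
    have hs1 : (1 : ℝ) ≤ s := by rw [hs]; linarith [T.cast_nonneg (α := ℝ)]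
    have hs0 : 0 < s := by linarith
    have hsinv : s⁻¹ ≤ 1 := inv_le_one_of_one_le₀ hs1
    have hb := rpow_one_add_le_one_add_mul_self (s := -s⁻¹) (by linarith) ha0.le ha1.le
    have hT : (T : ℝ) = s * (1 + -s⁻¹) := by
      rw [mul_add, mul_neg, mul_inv_cancel₀ hs0.ne', hs]; ring
    have h1 : (T : ℝ) ^ a ≤ s ^ a * (1 + a * -s⁻¹) := by
      rw [hT, Real.mul_rpow hs0.le (by linarith)]
      gcongr
    have h2 : (s ^ (1 - a))⁻¹ = s ^ a * s⁻¹ := by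
      rw [← Real.rpow_neg hs0.le, neg_sub, Real.rpow_sub hs0, Real.rpow_one, div_eq_mul_inv]
    rw [h2]
    rw [le_div_iff₀ ha0] at ih ⊢
    linarith

lemma rpow_succ_sub_le {κ : ℝ} (hκ0 : 0 < κ) {t : ℕ} (ht : 1 ≤ t) :
    ((t + 1 : ℕ) : ℝ) ^ (1 - κ) - (t : ℝ) ^ (1 - κ) ≤ (((t + 1 : ℕ) : ℝ) ^ κ)⁻¹ := by
  have ht0 : (0 : ℝ) < t := by exact_mod_cast ht
  have ht1 : (0 : ℝ) < (t + 1 : ℕ) := by positivity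
  rw [Real.rpow_sub ht0, Real.rpow_sub ht1, Real.rpow_one, Real.rpow_one]
  have h1 : (t : ℝ) / ((t + 1 : ℕ) : ℝ) ^ κ ≤ (t : ℝ) / (t : ℝ) ^ κ := by
    gcongr
    exact Nat.le_succ t
  have h2 : ((t + 1 : ℕ) : ℝ) / ((t + 1 : ℕ) : ℝ) ^ κ
      = (t : ℝ) / ((t + 1 : ℕ) : ℝ) ^ κ + (((t + 1 : ℕ) : ℝ) ^ κ)⁻¹ := by
    push_cast
    rw [add_div, one_div]
  linarith

/-- Weighted telescoping with a discount `μ` absorbing the growth of the weights from time `B` on. -/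
lemma sum_weighted_telescope_le {D c : ℕ → ℝ} {L μ : ℝ} {B T : ℕ} (hL : 0 ≤ L) (hμ : 0 ≤ μ)
    (hD0 : ∀ t, 1 ≤ t → 0 ≤ D t) (hDL : ∀ t, 1 ≤ t → D t ≤ L) (hc0 : ∀ t, 1 ≤ t → 0 ≤ c t)
    (hc : ∀ t, 1 ≤ t → c t ≤ c (t + 1)) (hB : 1 ≤ B)
    (hμB : ∀ t, B ≤ t → t ≤ T → c (t + 1) - c t ≤ μ) :
    ∑ t ∈ Finset.Icc 1 T, (c (t + 1) * (D t - D (t + 1)) - μ * D t) ≤ L * c B := by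
  have hmono : ∀ t, t + 1 ≤ B → c (t + 1) ≤ c B := fun t ht =>
    Nat.le_induction le_rfl (fun k hk ih => ih.trans (hc k (by omega))) B ht
  have key : ∀ k ≤ T, ∑ t ∈ Finset.Icc 1 k, (c (t + 1) * (D t - D (t + 1)) - μ * D t)
      + c (k + 1) * D (k + 1) ≤ L * c (min (k + 1) B) := by
    intro k
    induction k with
    | zero =>
      intro _
      rw [Nat.zero_add, min_eq_left hB]
      simpa [mul_comm L] using mul_le_mul_of_nonneg_left (hDL 1 le_rfl) (hc0 1 le_rfl)
    | succ k ih =>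
      intro hk
      have ih' := ih (by omega)
      rw [Finset.sum_Icc_succ_top (Nat.le_add_left 1 k)]
      have hd0 := hD0 (k + 1) (by omega)
      have hdL := hDL (k + 1) (by omega)
      rcases le_or_gt B (k + 1) with h | h
      · rw [min_eq_right h] at ih'
        rw [min_eq_right (by omega)]
        have := mul_nonneg (sub_nonneg.2 (hμB (k + 1) h hk)) hd0
        linarith
      · rw [min_eq_left h.le] at ih'
        rw [min_eq_left (by omega)]
        have h1 := mul_le_mul_of_nonneg_left hdL (sub_nonneg.2 (hc (k + 1) (by omega)))
        have h2 := mul_nonneg hμ hd0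
        linarith
  have h := key T le_rfl
  have h1 := mul_nonneg (hc0 (T + 1) (by omega)) (hD0 (T + 1) (by omega))
  have h2 : c (min (T + 1) B) ≤ c B := by
    rcases le_total (T + 1) B with h' | h'
    · rw [min_eq_left h']
      exact hmono T h'
    · rw [min_eq_right h']
  have h3 := mul_le_mul_of_nonneg_left h2 hL
  linarith

namespace Alg

variable {n m : ℕ} {p : Fin n → ℕ} (S : Alg n m p)

/-- Weighted consensus constant `n²τB₁F/(1−λ)`. -/
def consensusConst : ℝ := (n : ℝ) ^ 2 * S.tau * S.B1 * S.F / (1 - S.lam)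

lemma B1_pos : 0 < S.B1 := by
  have := S.hF
  have := mul_pos S.hG S.hdX
  rw [B1]
  linarith

lemma le_consensusConst :
    2 * ((n : ℝ) ^ 4 * S.iota / S.w * S.B1 * S.F) ≤ S.consensusConst := by
  have hn1 : (1 : ℝ) ≤ n := by exact_mod_cast S.hn
  have hw0 := S.hw0
  have hw1 := S.hw1
  have hι0 : (0 : ℝ) < S.iota := by exact_mod_cast S.hiota
  set ρ := 1 - S.w / (2 * (n : ℝ) ^ 2) with hρ
  have hδ : 0 < S.w / (2 * (n : ℝ) ^ 2) := by positivity
  have hδ1 : S.w / (2 * (n : ℝ) ^ 2) < 1 := by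
    rw [div_lt_one (by positivity)]
    have := one_le_pow₀ (n := 2) hn1
    linarith
  have hρ0 : 0 < ρ := by linarith
  have hρ1 : ρ < 1 := by linarith
  have hlam : S.lam = ρ ^ ((S.iota : ℝ))⁻¹ := rfl
  have hl0 : 0 ≤ S.lam := by rw [hlam]; positivity
  have hl1 : S.lam < 1 := by
    rw [hlam]
    exact Real.rpow_lt_one hρ0.le hρ1 (by positivity)
  have hpow : S.lam ^ S.iota = ρ := by
    rw [hlam, Real.rpow_inv_natCast_pow hρ0.le S.hiota.ne']
  have hgeom := geom_sum_mul_neg S.lam S.iota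
  have hsum : S.iota * ρ ≤ ∑ k ∈ Finset.range S.iota, S.lam ^ k := by
    rw [← hpow, ← nsmul_eq_mul, ← Finset.card_range S.iota, ← Finset.sum_const,
      Finset.card_range]
    exact Finset.sum_le_sum fun k hk =>
      pow_le_pow_of_le_one hl0 hl1.le (Finset.mem_range.1 hk).le
  have h1 : S.iota * ρ * (1 - S.lam) ≤ 1 - ρ := by
    rw [← hpow, ← hgeom, hpow]
    exact mul_le_mul_of_nonneg_right hsum (by linarith)
  have h2 : S.iota * ρ ^ 2 * (1 - S.lam) ≤ S.w / (2 * (n : ℝ) ^ 2) := by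
    have h3 : S.iota * ρ * (1 - S.lam) * ρ ≤ (1 - ρ) * 1 :=
      mul_le_mul h1 hρ1.le hρ0.le (by linarith)
    have h4 : 1 - ρ = S.w / (2 * (n : ℝ) ^ 2) := by rw [hρ]; ring
    rw [← h4]
    linarith
  have hl : 0 < 1 - S.lam := by linarith
  have hB := S.B1_pos
  have hF := S.hF
  rw [le_div_iff₀ (by positivity)] at h2
  rw [consensusConst, tau, ← hρ, le_div_iff₀ hl]
  calc 2 * ((n : ℝ) ^ 4 * S.iota / S.w * S.B1 * S.F) * (1 - S.lam)
      = (S.iota * ρ ^ 2 * (1 - S.lam) * (2 * (n : ℝ) ^ 2))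
        * ((n : ℝ) ^ 2 * (ρ ^ 2)⁻¹ * S.B1 * S.F / S.w) := by field_simp
    _ ≤ S.w * ((n : ℝ) ^ 2 * (ρ ^ 2)⁻¹ * S.B1 * S.F / S.w) := by gcongr
    _ = _ := by field_simp

lemma sum_disagreement_q_le (hγβ : ∀ t, 1 ≤ t → S.γ t * S.β t ≤ 1) (T : ℕ) :
    ∑ t ∈ Finset.Icc 1 T, S.F * (√n * ‖disagreement (S.q t)‖)
      ≤ S.consensusConst / 2 * ∑ t ∈ Finset.Icc 1 T, S.γ t := by
  have hn0 : (0 : ℝ) < n := by exact_mod_cast S.hn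
  have hw0 := S.hw0
  have hF := S.hF
  have hB := S.B1_pos
  have h := sum_norm_disagreement_perturbed_le S.W S.isDoublyStoch S.hw0 S.hw1 S.hWdiag S.hWpos
    S.hconn S.hn S.q (fun t => S.q (t + 1) - S.qtil (t + 1)) (funext S.hq0)
    (fun t => by rw [← S.qtil_succ]; abel) T
  have hε : ∑ t ∈ Finset.range T, ‖disagreement (S.q (t + 1) - S.qtil (t + 1))‖
      ≤ √n * S.B1 * ∑ t ∈ Finset.Icc 1 T, S.γ t := by
    rw [Finset.mul_sum, Finset.range_eq_Ico, Finset.sum_Ico_add' (fun t =>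
      ‖disagreement (S.q t - S.qtil t)‖) 0 T 1]
    refine Finset.sum_le_sum fun t ht => ?_
    obtain ⟨s, rfl⟩ := Nat.exists_eq_add_of_le' (Finset.mem_Ico.1 ht).1
    have hγ := S.hγpos _ (Nat.le_add_left 1 s)
    refine (norm_disagreement_le_sqrt_mul _ (c := S.γ (s + 1) * S.B1) (by positivity)
      (S.norm_q_sub_qtil_le hγβ s)).trans (le_of_eq (by ring))
  have hsub : ∑ t ∈ Finset.Icc 1 T, ‖disagreement (S.q t)‖
      ≤ ∑ t ∈ Finset.range (T + 1), ‖disagreement (S.q t)‖ := by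
    refine Finset.sum_le_sum_of_subset_of_nonneg (fun t ht => ?_) fun t _ _ => norm_nonneg _
    rw [Finset.mem_Icc] at ht
    exact Finset.mem_range.2 (by omega)
  have hΓ : 0 ≤ ∑ t ∈ Finset.Icc 1 T, S.γ t :=
    Finset.sum_nonneg fun t ht => (S.hγpos t (Finset.mem_Icc.1 ht).1).le
  have h1 : ∑ t ∈ Finset.Icc 1 T, ‖disagreement (S.q t)‖
      ≤ (n : ℝ) ^ 3 / S.w * (S.iota * (√n * S.B1 * ∑ t ∈ Finset.Icc 1 T, S.γ t)) := by
    have h2 : S.w / (n : ℝ) ^ 3 * ∑ t ∈ Finset.Icc 1 T, ‖disagreement (S.q t)‖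
        ≤ S.iota * (√n * S.B1 * ∑ t ∈ Finset.Icc 1 T, S.γ t) :=
      (mul_le_mul_of_nonneg_left hsub (by positivity)).trans (h.trans (by gcongr))
    calc ∑ t ∈ Finset.Icc 1 T, ‖disagreement (S.q t)‖
        = (n : ℝ) ^ 3 / S.w * (S.w / (n : ℝ) ^ 3 *
          ∑ t ∈ Finset.Icc 1 T, ‖disagreement (S.q t)‖) := by field_simp
      _ ≤ _ := by gcongr
  calc ∑ t ∈ Finset.Icc 1 T, S.F * (√n * ‖disagreement (S.q t)‖)
      = S.F * √n * ∑ t ∈ Finset.Icc 1 T, ‖disagreement (S.q t)‖ := by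
        rw [Finset.mul_sum]
        exact Finset.sum_congr rfl fun t _ => by ring
    _ ≤ S.F * √n
        * ((n : ℝ) ^ 3 / S.w * (S.iota * (√n * S.B1 * ∑ t ∈ Finset.Icc 1 T, S.γ t))) := by gcongr
    _ = √n ^ 2 * (n : ℝ) ^ 3 * S.iota / S.w * S.B1 * S.F * ∑ t ∈ Finset.Icc 1 T, S.γ t := by ring
    _ = (n : ℝ) ^ 4 * S.iota / S.w * S.B1 * S.F * ∑ t ∈ Finset.Icc 1 T, S.γ t := by
        rw [Real.sq_sqrt hn0.le]; ring
    _ ≤ _ := by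
        have := S.le_consensusConst
        gcongr
        linarith

lemma sum_inner_qtil_le {t : ℕ} {y : ∀ i, EuclideanSpace ℝ (Fin (p i))} (hy : ∀ i, y i ∈ S.X i)
    (hfeas : ∀ j, S.gsum t y j ≤ 0) :
    ∑ i, ⟪S.qtil (t + 1) i, S.g t i (y i)⟫ ≤ S.F * (√n * ‖disagreement (S.q t)‖) := by
  set c := (n : ℝ)⁻¹ • ∑ j, S.qtil (t + 1) j with hc
  have hcnn : ∀ j, 0 ≤ c j := by
    intro j
    simp only [hc, PiLp.smul_apply, WithLp.ofLp_sum, Finset.sum_apply, smul_eq_mul]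
    exact mul_nonneg (by positivity) (Finset.sum_nonneg fun i _ => S.qtil_nonneg t i j)
  have h1 : ∑ i, ⟪S.qtil (t + 1) i, S.g t i (y i)⟫
      = ∑ i, ⟪S.qtil (t + 1) i - c, S.g t i (y i)⟫ + ⟪c, S.gsum t y⟫ := by
    simp only [inner_sub_left, Finset.sum_sub_distrib, gsum, inner_sum]
    ring
  have h2 : ⟪c, S.gsum t y⟫ ≤ 0 := by
    have := inner_le_inner_of_nonneg (v' := 0) hcnn hfeas
    simpa using this
  have h3 : ∑ i, ⟪S.qtil (t + 1) i - c, S.g t i (y i)⟫ ≤ ∑ i, ‖S.qtil (t + 1) i - c‖ * S.F :=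
    Finset.sum_le_sum fun i _ => (real_inner_le_norm _ _).trans
      (mul_le_mul_of_nonneg_left (S.hgbound t i _ (hy i)) (norm_nonneg _))
  have h4 := sum_norm_disagreement_le (S.qtil (t + 1))
  have h5 : ‖disagreement (S.qtil (t + 1))‖ ≤ ‖disagreement (S.q t)‖ := by
    rw [S.qtil_succ]
    exact (S.isDoublyStoch t).norm_disagreement_mixing_le _
  rw [← Finset.sum_mul, mul_comm] at h3
  have h6 : S.F * ∑ i, ‖S.qtil (t + 1) i - c‖ ≤ S.F * (√n * ‖disagreement (S.q t)‖) := by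
    have := S.hF
    gcongr
    exact h4.trans (by gcongr)
  linarith

lemma sum_dual_telescope_le {κ : ℝ} (hκ0 : 0 < κ)
    (hβ : ∀ t : ℕ, 1 ≤ t → S.β t = ((t : ℝ) ^ κ)⁻¹)
    (hγ : ∀ t : ℕ, 1 ≤ t → S.γ t = ((t : ℝ) ^ (1 - κ))⁻¹) (T : ℕ) :
    ∑ t ∈ Finset.Icc 1 T, ((2 * S.γ (t + 1))⁻¹
        * (∑ i, ‖S.qtil (t + 1) i‖ ^ 2 - ∑ i, ‖S.q (t + 1) i‖ ^ 2)
      - S.β (t + 1) * ∑ i, ‖S.qtil (t + 1) i‖ ^ 2) ≤ 0 := by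
  have key : ∀ T : ℕ, ∑ t ∈ Finset.Icc 1 T, ((2 * S.γ (t + 1))⁻¹
        * (∑ i, ‖S.qtil (t + 1) i‖ ^ 2 - ∑ i, ‖S.q (t + 1) i‖ ^ 2)
      - S.β (t + 1) * ∑ i, ‖S.qtil (t + 1) i‖ ^ 2)
      + (2 * S.γ (T + 1))⁻¹ * ∑ i, ‖S.q (T + 1) i‖ ^ 2 ≤ 0 := by
    intro T
    induction T with
    | zero => simp [S.q_one]
    | succ T ih =>
      rw [Finset.sum_Icc_succ_top (Nat.le_add_left 1 T)]
      have hQ := S.sum_norm_qtil_sq_le (T + 1)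
      have hQ0 : 0 ≤ ∑ i, ‖S.qtil (T + 1 + 1) i‖ ^ 2 := Finset.sum_nonneg fun i _ => sq_nonneg _
      have hγ1 := S.hγpos (T + 1) (by omega)
      have hinc := rpow_succ_sub_le hκ0 (t := T + 1) (by omega)
      rw [← hβ _ (by omega), ← inv_inv (((T + 1 + 1 : ℕ) : ℝ) ^ (1 - κ)), ← hγ _ (by omega),
        ← inv_inv (((T + 1 : ℕ) : ℝ) ^ (1 - κ)), ← hγ _ (by omega)] at hinc
      rw [mul_inv] at ih ⊢
      have hβ0 := S.hβpos (T + 1 + 1) (by omega)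
      have h1 := mul_le_mul_of_nonneg_left hQ (inv_pos.2 hγ1).le
      have h2 := mul_le_mul_of_nonneg_right hinc hQ0
      have h3 := mul_nonneg hβ0.le hQ0
      linarith
  have h := key T
  have hγ1 := S.hγpos (T + 1) (by omega)
  have : 0 ≤ (2 * S.γ (T + 1))⁻¹ * ∑ i, ‖S.q (T + 1) i‖ ^ 2 :=
    mul_nonneg (by positivity) (Finset.sum_nonneg fun i _ => sq_nonneg _)
  linarith

/-- Regret bound in terms of the stepsizes, before choosing the time `B` from which strong convexity
absorbs the growth of `1 / α`. -/
lemma reg_le (hΦid : ∀ t i (z : EuclideanSpace ℝ (Fin (p i))), S.Φ t i z = z)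
    (μ : Fin n → ℝ) (hμ : ∀ i, 0 < μ i)
    (hstrconv : ∀ t : ℕ, 1 ≤ t → ∀ i, ∀ z ∈ S.X i, ∀ u ∈ S.X i,
      S.f t i u + ⟪z - u, S.Gf t i u⟫ + μ i * breg (S.ψ i) (S.ψ' i) z u ≤ S.f t i z)
    {κ : ℝ} (hκ0 : 0 < κ)
    (hβ : ∀ t : ℕ, 1 ≤ t → S.β t = ((t : ℝ) ^ κ)⁻¹)
    (hγ : ∀ t : ℕ, 1 ≤ t → S.γ t = ((t : ℝ) ^ (1 - κ))⁻¹)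
    {T : ℕ} {y : ∀ i, EuclideanSpace ℝ (Fin (p i))} (hy : ∀ i, y i ∈ S.X i)
    (hfeas : ∀ t ∈ Finset.Icc 1 T, ∀ j, S.gsum t y j ≤ 0) {B : ℕ} (hB : 1 ≤ B)
    (hμB : ∀ i t, B ≤ t → t ≤ T → (S.α (t + 1))⁻¹ - (S.α t)⁻¹ ≤ μ i) :
    S.reg T (fun _ => y)
      ≤ S.C12 / 2 * ∑ t ∈ Finset.Icc 1 T, S.α t + n * (S.K * S.dX * (S.α B)⁻¹)
        + (n * S.B1 ^ 2 / 2 + S.consensusConst / 2) * ∑ t ∈ Finset.Icc 1 T, S.γ t := by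
  have hn0 : (0 : ℝ) < n := by exact_mod_cast S.hn
  have hγβ : ∀ t, 1 ≤ t → S.γ t * S.β t ≤ 1 := by
    intro t ht
    have ht0 : (0 : ℝ) < t := by exact_mod_cast ht
    rw [hβ t ht, hγ t ht, ← mul_inv, ← Real.rpow_add ht0, sub_add_cancel, Real.rpow_one]
    exact inv_le_one_of_one_le₀ (by exact_mod_cast ht)
  have hstep : ∀ t ∈ Finset.Icc 1 T, S.fsum t (S.x t) - S.fsum t y
      ≤ S.C12 / 2 * S.α t
        + ∑ i, ((S.α (t + 1))⁻¹ * (breg (S.ψ i) (S.ψ' i) (y i) (S.x t i)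
            - breg (S.ψ i) (S.ψ' i) (y i) (S.x (t + 1) i))
          - μ i * breg (S.ψ i) (S.ψ' i) (y i) (S.x t i))
        + ((2 * S.γ (t + 1))⁻¹
            * (∑ i, ‖S.qtil (t + 1) i‖ ^ 2 - ∑ i, ‖S.q (t + 1) i‖ ^ 2)
          - S.β (t + 1) * ∑ i, ‖S.qtil (t + 1) i‖ ^ 2)
        + n * S.B1 ^ 2 / 2 * S.γ t + S.F * (√n * ‖disagreement (S.q t)‖) := by
    intro t ht
    have ht1 := (Finset.mem_Icc.1 ht).1
    have h1 := Finset.sum_le_sum fun i (_ : i ∈ Finset.univ) => add_le_add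
      (S.primal_descent hΦid μ hstrconv ht1 i (hy i)) (S.dual_descent hγβ t i)
    have h2 := S.sum_inner_qtil_le hy (hfeas t ht)
    simp only [Finset.sum_add_distrib, Finset.sum_sub_distrib, Finset.sum_neg_distrib,
      Finset.sum_const, Finset.card_univ, Fintype.card_fin, nsmul_eq_mul, ← Finset.mul_sum] at h1
    simp only [fsum, Finset.sum_add_distrib, Finset.sum_sub_distrib, ← Finset.mul_sum]
    have h3 : n * (2 * S.G ^ 2 / S.sigmin * S.α (t + 1)) ≤ S.C12 / 2 * S.α t := by
      have hσ := S.sigmin_pos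
      have : n * (2 * S.G ^ 2 / S.sigmin * S.α (t + 1)) = S.C12 / 2 * S.α (t + 1) := by
        rw [C12]; ring
      rw [this]
      refine mul_le_mul_of_nonneg_left (S.hαanti _ _ ht1 (Nat.le_succ t)) ?_
      rw [C12]
      positivity
    have h4 : n * (S.γ (t + 1) / 2 * S.B1 ^ 2) ≤ n * S.B1 ^ 2 / 2 * S.γ t := by
      have := mul_le_mul_of_nonneg_left (S.hγanti _ _ ht1 (Nat.le_succ t))
        (show 0 ≤ n * S.B1 ^ 2 / 2 by positivity)
      linarith
    linarith
  have hsum := Finset.sum_le_sum hstep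
  have htel : ∑ t ∈ Finset.Icc 1 T,
      ∑ i, ((S.α (t + 1))⁻¹ * (breg (S.ψ i) (S.ψ' i) (y i) (S.x t i)
            - breg (S.ψ i) (S.ψ' i) (y i) (S.x (t + 1) i))
          - μ i * breg (S.ψ i) (S.ψ' i) (y i) (S.x t i))
      ≤ n * (S.K * S.dX * (S.α B)⁻¹) := by
    rw [Finset.sum_comm]
    calc _ ≤ ∑ _i : Fin n, S.K * S.dX * (S.α B)⁻¹ := Finset.sum_le_sum fun i _ =>
          sum_weighted_telescope_le (D := fun t => breg (S.ψ i) (S.ψ' i) (y i) (S.x t i))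
            (c := fun t => (S.α t)⁻¹) (mul_nonneg S.hK.le S.hdX.le) (hμ i).le
            (fun t _ => S.breg_nonneg (hy i) (S.x_mem t i))
            (fun t _ => S.breg_le (hy i) (S.x_mem t i))
            (fun t ht => (inv_pos.2 (S.hαpos t ht)).le)
            (fun t ht => inv_anti₀ (S.hαpos _ (by omega)) (S.hαanti _ _ ht (Nat.le_succ t)))
            hB (hμB i)
      _ = _ := by simp
  have hdual := S.sum_dual_telescope_le hκ0 hβ hγ T
  have hcons := S.sum_disagreement_q_le hγβ T
  rw [Finset.sum_add_distrib, Finset.sum_add_distrib, Finset.sum_add_distrib,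
    Finset.sum_add_distrib, ← Finset.mul_sum, ← Finset.mul_sum, Finset.sum_sub_distrib] at hsum
  rw [reg]
  linarith

end Alg

theorem statement_14 {n m : ℕ} {p : Fin n → ℕ} (S : Alg n m p)
    (hΦid : ∀ t i (z : EuclideanSpace ℝ (Fin (p i))), S.Φ t i z = z)
    (μ : Fin n → ℝ) (hμ : ∀ i, 0 < μ i)
    (hstrconv : ∀ t : ℕ, 1 ≤ t → ∀ i, ∀ z ∈ S.X i, ∀ u ∈ S.X i,
      S.f t i u + ⟪z - u, S.Gf t i u⟫ + μ i * breg (S.ψ i) (S.ψ' i) z u ≤ S.f t i z)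
    (μmin : ℝ) (hμmin : IsLeast (Set.range μ) μmin)
    (κ : ℝ) (hκ0 : 0 < κ) (hκ1 : κ < 1)
    (hα : ∀ t : ℕ, 1 ≤ t → S.α t = ((t : ℝ) ^ max (1 - κ) κ)⁻¹)
    (hβ : ∀ t : ℕ, 1 ≤ t → S.β t = ((t : ℝ) ^ κ)⁻¹)
    (hγ : ∀ t : ℕ, 1 ≤ t → S.γ t = ((t : ℝ) ^ (1 - κ))⁻¹)
    (T : ℕ) (hT : 1 ≤ T)
    (xc : ∀ i, EuclideanSpace ℝ (Fin (p i))) (hxcmem : ∀ i, xc i ∈ S.X i)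
    (hxcfeas : ∀ t ∈ Finset.Icc 1 T, ∀ j, S.gsum t xc j ≤ 0)
    (hxcopt : ∀ z : ∀ i, EuclideanSpace ℝ (Fin (p i)), (∀ i, z i ∈ S.X i) →
      (∀ t ∈ Finset.Icc 1 T, ∀ j, S.gsum t z j ≤ 0) →
      ∑ t ∈ Finset.Icc 1 T, S.fsum t xc ≤ ∑ t ∈ Finset.Icc 1 T, S.fsum t z) :
    S.reg T (fun _ => xc) ≤ max (S.C11 / κ + S.C12 / (1 - max (1 - κ) κ) + 2 * (n : ℝ) * S.dX * S.K) ((n : ℝ) * S.B1 ^ 2 / (2 * κ) + S.B1 * S.C11 / κ + S.C12 / κ + 2 * (n : ℝ) * S.dX * S.K * ((⌈(μmin ^ κ⁻¹)⁻¹⌉₊ : ℝ)) ^ (1 - κ)) * (T : ℝ) ^ κ := by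
  have hn0 : (0 : ℝ) < n := by exact_mod_cast S.hn
  have hB1 := S.B1_pos
  have hF := S.hF
  have hw0 := S.hw0
  have hE : 0 ≤ S.consensusConst := le_trans (by positivity) S.le_consensusConst
  have hC12 : 0 ≤ S.C12 := by
    have := S.sigmin_pos
    rw [Alg.C12]
    positivity
  have hC11 : S.C11 = 3 * S.consensusConst + n * S.B1 ^ 2 / 2 := by
    rw [Alg.C11, Alg.consensusConst]
    ring
  have hnKd : 0 < n * (S.K * S.dX) := mul_pos hn0 (mul_pos S.hK S.hdX)
  have hT1 : (1 : ℝ) ≤ T := by exact_mod_cast hT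
  have hP1 : 1 ≤ (T : ℝ) ^ κ := Real.one_le_rpow hT1 hκ0.le
  have hA : 0 ≤ n * S.B1 ^ 2 := by positivity
  have hsumγ : ∑ t ∈ Finset.Icc 1 T, S.γ t ≤ (T : ℝ) ^ κ / κ := by
    rw [Finset.sum_congr rfl fun t ht => hγ t (Finset.mem_Icc.1 ht).1]
    exact sum_Icc_rpow_inv_le hκ0 hκ1 T
  have hγterm := mul_le_mul_of_nonneg_left hsumγ
    (show 0 ≤ n * S.B1 ^ 2 / 2 + S.consensusConst / 2 by linarith)
  have hM0 : 0 < max (1 - κ) κ := lt_max_of_lt_right hκ0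
  have hM1 : max (1 - κ) κ < 1 := max_lt (by linarith) hκ1
  have hsumα : ∑ t ∈ Finset.Icc 1 T, S.α t ≤ (T : ℝ) ^ κ / (1 - max (1 - κ) κ) := by
    rw [Finset.sum_congr rfl fun t ht => hα t (Finset.mem_Icc.1 ht).1]
    have h := sum_Icc_rpow_inv_le (a := 1 - max (1 - κ) κ) (by linarith) (by linarith) T
    rw [sub_sub_cancel] at h
    refine h.trans (div_le_div_of_nonneg_right ?_ (by linarith))
    exact Real.rpow_le_rpow_of_exponent_le hT1 (by linarith [le_max_left (1 - κ) κ])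
  have hαterm := mul_le_mul_of_nonneg_left hsumα (show 0 ≤ S.C12 / 2 by linarith)
  set P := (T : ℝ) ^ κ
  have hEP : 0 ≤ S.consensusConst * P / κ := by positivity
  have hC12P : 0 ≤ S.C12 * P / (1 - max (1 - κ) κ) := by
    have : 0 < 1 - max (1 - κ) κ := by linarith
    positivity
  rcases le_or_gt (1 - κ) κ with hκ | hκ
  · have h := S.reg_le hΦid μ hμ hstrconv hκ0 hβ hγ hxcmem hxcfeas (B := T + 1) (by omega)
      fun i t h1 h2 => by omega
    refine h.trans (le_trans ?_ (mul_le_mul_of_nonneg_right (le_max_left _ _) (by linarith)))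
    have hαT : (S.α (T + 1))⁻¹ ≤ 2 * P := by
      rw [hα _ (by omega), inv_inv, max_eq_right hκ]
      calc ((T + 1 : ℕ) : ℝ) ^ κ ≤ (2 * T) ^ κ := by
            refine Real.rpow_le_rpow (by positivity) ?_ hκ0.le
            push_cast
            linarith
        _ = 2 ^ κ * P := Real.mul_rpow (by norm_num) (by linarith)
        _ ≤ 2 * P := by
            refine mul_le_mul_of_nonneg_right ?_ (by linarith)
            exact Real.rpow_le_self_of_one_le (by norm_num) hκ1.le
    have hd := mul_le_mul_of_nonneg_left hαT hnKd.le
    rw [hC11]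
    linear_combination hd + hαterm + hγterm + 5 / 2 * hEP + 1 / 2 * hC12P
  · rw [max_eq_left hκ.le, sub_sub_cancel] at hαterm hC12P ⊢
    obtain ⟨⟨i₀, hi₀⟩, hleast⟩ := hμmin
    have hμ0 : 0 < μmin := hi₀ ▸ hμ i₀
    set B := ⌈(μmin ^ κ⁻¹)⁻¹⌉₊
    have hB : 1 ≤ B := Nat.ceil_pos.2 (by positivity)
    have h := S.reg_le hΦid μ hμ hstrconv hκ0 hβ hγ hxcmem hxcfeas hB
      fun i t h1 _ => by
        have ht1 : 1 ≤ t := hB.trans h1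
        rw [hα _ ht1, hα _ (by omega), inv_inv, inv_inv, max_eq_left hκ.le]
        refine (rpow_succ_sub_le hκ0 ht1).trans (le_trans ?_ (hleast ⟨i, rfl⟩))
        have hle : (μmin ^ κ⁻¹)⁻¹ ≤ ((t + 1 : ℕ) : ℝ) :=
          (Nat.le_ceil _).trans (by exact_mod_cast h1.trans (Nat.le_succ t))
        have h2 := Real.rpow_le_rpow (by positivity) hle hκ0.le
        rw [Real.inv_rpow (by positivity), Real.rpow_inv_rpow hμ0.le hκ0.ne'] at h2
        exact inv_le_of_inv_le₀ hμ0 h2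
    rw [hα _ hB, inv_inv, max_eq_left hκ.le] at h
    set Q := (B : ℝ) ^ (1 - κ)
    have hQ0 : 0 ≤ Q := by positivity
    have hQP : n * (S.K * S.dX) * Q * 1 ≤ n * (S.K * S.dX) * Q * P :=
      mul_le_mul_of_nonneg_left hP1 (by positivity)
    have hdP : 0 ≤ n * (S.K * S.dX) * P := by positivity
    have hBC : 0 ≤ S.B1 * S.C11 / κ * P := by
      rw [hC11]
      positivity
    have hl := mul_le_mul_of_nonneg_right (le_max_left
      (S.C11 / κ + S.C12 / κ + 2 * n * S.dX * S.K)
      (n * S.B1 ^ 2 / (2 * κ) + S.B1 * S.C11 / κ + S.C12 / κ + 2 * n * S.dX * S.K * Q))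
      (show 0 ≤ P by linarith)
    have hr := mul_le_mul_of_nonneg_right (le_max_right
      (S.C11 / κ + S.C12 / κ + 2 * n * S.dX * S.K)
      (n * S.B1 ^ 2 / (2 * κ) + S.B1 * S.C11 / κ + S.C12 / κ + 2 * n * S.dX * S.K * Q))
      (show 0 ≤ P by linarith)
    refine h.trans ?_
    rw [hC11] at hl hr hBC ⊢
    linear_combination hαterm + hγterm + hQP + 1 / 2 * hl + 1 / 2 * hr + hEP + 1 / 2 * hBC
      + 1 / 2 * hC12P + hdP

end
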